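/- arXiv:math/0103152 — 3 statements merged into one kernel-verified Lean document; each statement's English description precedes it below -/
import Mathlib

section
/- The patterns 213 and 132 are shape-Wilf-equivalent: for every Young diagram Y, the number of transversals of Y avoiding 213 equals the number of transversals of Y avoiding 132. -/
/-- A Young diagram of size `n` (coordinates from the bottom-left, as in the paper):
`b i` is the length of the `i`-th row counted from the bottom, for `i < n`.
Rows get longer going up (top row is the largest), the staircase
`Y(n, n-1, ..., 1)` is contained (`i < b i`), and there are `n` columns (`b i ≤ n`). -/
def IsYoungShape (n : ℕ) (b : ℕ → ℕ) : Prop :=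
  (∀ i j : ℕ, i ≤ j → j < n → b i ≤ b j) ∧ ∀ i : ℕ, i < n → i < b i ∧ b i ≤ n

/-- A transversal of the shape `b`, encoded as a permutation sending each column `i`
(from the left) to the row `π i` (from the bottom) of the unique 1 in that column:
every cell `(column i, row π i)` must lie inside the diagram. -/
def IsTransversal (n : ℕ) (b : ℕ → ℕ) (π : Equiv.Perm (Fin n)) : Prop :=
  ∀ i : Fin n, (i : ℕ) < b (π i)

/-- The transversal `π` of the shape `b` contains the pattern `τ`: some `k` of its 1's
form a submatrix of the diagram (all crossing cells inside the diagram) identical to the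
permutation matrix of `τ`. -/
def ShapeContains (n : ℕ) (b : ℕ → ℕ) {k : ℕ} (π : Fin n → Fin n) (τ : Fin k → Fin k) : Prop :=
  ∃ f : Fin k ↪o Fin n,
    (∀ a c : Fin k, τ a < τ c ↔ π (f a) < π (f c)) ∧
    ∀ a c : Fin k, (f a : ℕ) < b (π (f c))

/-- The number of transversals of the shape `b` avoiding the pattern `τ`,
i.e. `|S_Y(τ)|`. -/
noncomputable def shapeAvoidCard (n : ℕ) (b : ℕ → ℕ) {k : ℕ} (τ : Fin k → Fin k) : ℕ :=
  Nat.card {π : Equiv.Perm (Fin n) // IsTransversal n b π ∧ ¬ ShapeContains n b ⇑π τ}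

/-- Shape-Wilf-equivalence: equally many avoiders on every Young diagram. -/
def ShapeWilfEquiv {k l : ℕ} (τ : Fin k → Fin k) (σ : Fin l → Fin l) : Prop :=
  ∀ (n : ℕ) (b : ℕ → ℕ), IsYoungShape n b → shapeAvoidCard n b τ = shapeAvoidCard n b σ

/-- Formal power series over `ℤ` in two noncommuting variables, indexed by words in `Bool`. -/
def WordSeries : Type := List Bool → ℤ

namespace WordSeries

@[ext] theorem ext {f g : WordSeries} (h : ∀ w, f w = g w) : f = g := funext h

instance : AddCommGroup WordSeries := inferInstanceAs (AddCommGroup (List Bool → ℤ))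

@[simp] theorem add_apply (f g : WordSeries) (w : List Bool) : (f + g) w = f w + g w := rfl
@[simp] theorem sub_apply (f g : WordSeries) (w : List Bool) : (f - g) w = f w - g w := rfl
@[simp] theorem zero_apply (w : List Bool) : (0 : WordSeries) w = 0 := rfl
@[simp] theorem zsmul_apply (c : ℤ) (f : WordSeries) (w : List Bool) : (c • f) w = c * f w := rfl

theorem sum_apply {ι : Type*} (s : Finset ι) (f : ι → WordSeries) (w : List Bool) :
    (∑ i ∈ s, f i) w = ∑ i ∈ s, f i w := Finset.sum_apply w s f

/-- The left derivative of a series by a letter. -/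
def leftDeriv (c : Bool) (f : WordSeries) : WordSeries := fun w => f (c :: w)

/-- The convolution product, by recursion on the word. -/
def conv : WordSeries → WordSeries → List Bool → ℤ
  | f, g, [] => f [] * g []
  | f, g, c :: w => f [] * g (c :: w) + conv (leftDeriv c f) g w

instance : Mul WordSeries := ⟨conv⟩
instance : One WordSeries := ⟨fun w => if w = [] then 1 else 0⟩

theorem one_apply (w : List Bool) : (1 : WordSeries) w = if w = [] then 1 else 0 := rfl
@[simp] theorem mul_nil (f g : WordSeries) : (f * g) [] = f [] * g [] := rfl
theorem mul_cons (f g : WordSeries) (c : Bool) (w : List Bool) :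
    (f * g) (c :: w) = f [] * g (c :: w) + (leftDeriv c f * g) w := rfl

@[simp] theorem leftDeriv_add (c : Bool) (f g : WordSeries) :
    leftDeriv c (f + g) = leftDeriv c f + leftDeriv c g := rfl
@[simp] theorem leftDeriv_zsmul (c : Bool) (a : ℤ) (f : WordSeries) :
    leftDeriv c (a • f) = a • leftDeriv c f := rfl
@[simp] theorem leftDeriv_zero (c : Bool) : leftDeriv c 0 = 0 := rfl
@[simp] theorem leftDeriv_one (c : Bool) : leftDeriv c 1 = 0 := rfl

protected theorem add_mul' (f g h : WordSeries) : (f + g) * h = f * h + g * h := by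
  ext w
  induction w generalizing f g with
  | nil => simp [add_mul]
  | cons c w ih => simp only [mul_cons, leftDeriv_add, ih, add_apply]; ring

protected theorem zsmul_mul' (a : ℤ) (f g : WordSeries) : (a • f) * g = a • (f * g) := by
  ext w
  induction w generalizing f with
  | nil => simp [mul_assoc]
  | cons c w ih => simp only [mul_cons, leftDeriv_zsmul, ih, zsmul_apply]; ring

protected theorem mul_add' (f g h : WordSeries) : f * (g + h) = f * g + f * h := by
  ext w
  induction w generalizing f with
  | nil => simp [mul_add]
  | cons c w ih => simp only [mul_cons, ih, add_apply]; ring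

protected theorem zero_mul' (f : WordSeries) : 0 * f = 0 := by
  ext w
  induction w with
  | nil => simp
  | cons c w ih => simp [mul_cons, ih]

protected theorem mul_zero' (f : WordSeries) : f * 0 = 0 := by
  ext w
  induction w generalizing f with
  | nil => simp
  | cons c w ih => simp [mul_cons, ih]

theorem leftDeriv_mul (c : Bool) (f g : WordSeries) :
    leftDeriv c (f * g) = f [] • leftDeriv c g + leftDeriv c f * g := rfl

protected theorem mul_assoc' (f g h : WordSeries) : f * g * h = f * (g * h) := by
  ext w
  induction w generalizing f with
  | nil => simp [mul_assoc]
  | cons c w ih =>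
    rw [mul_cons, mul_cons, leftDeriv_mul, WordSeries.add_mul', WordSeries.zsmul_mul', add_apply, ih,
      mul_cons, zsmul_apply, mul_nil]
    ring

instance : Ring WordSeries where
  left_distrib := WordSeries.mul_add'
  right_distrib := WordSeries.add_mul'
  zero_mul := WordSeries.zero_mul'
  mul_zero := WordSeries.mul_zero'
  mul_assoc := WordSeries.mul_assoc'
  one_mul f := by
    ext w
    cases w with
    | nil => simp [one_apply]
    | cons c w => simp [mul_cons, one_apply, WordSeries.zero_mul']
  mul_one f := by
    ext w
    induction w generalizing f with
    | nil => simp [one_apply]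
    | cons c w ih => simp [mul_cons, one_apply, ih, leftDeriv]
  zsmul := fun a f => a • f
  zsmul_zero' := fun f => zero_zsmul f
  zsmul_succ' := fun n f => SubNegMonoid.zsmul_succ' n f
  zsmul_neg' := fun n f => SubNegMonoid.zsmul_neg' n f
  neg_add_cancel := neg_add_cancel
  sub_eq_add_neg := sub_eq_add_neg

/-- The series consisting of a single letter. -/
def letter (c : Bool) : WordSeries := fun w => if w = [c] then 1 else 0

@[simp] theorem letter_nil (c : Bool) : letter c [] = 0 := rfl

theorem leftDeriv_letter (c d : Bool) : leftDeriv c (letter d) = if c = d then 1 else 0 := by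
  ext w
  by_cases h : c = d <;> simp [leftDeriv, letter, one_apply, h]

theorem leftDeriv_letter_mul (c d : Bool) (f : WordSeries) :
    leftDeriv c (letter d * f) = if c = d then f else 0 := by
  rw [leftDeriv_mul, leftDeriv_letter]
  split_ifs <;> simp

theorem letter_mul_cons (c d : Bool) (f : WordSeries) (w : List Bool) :
    (letter d * f) (c :: w) = if c = d then f w else 0 := by
  have := congrFun (leftDeriv_letter_mul c d f) w
  split_ifs with h <;> simpa [leftDeriv, h] using this

/-- The right derivative of a series by a letter. -/
def rightDeriv (c : Bool) (f : WordSeries) : WordSeries := fun w => f (w ++ [c])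

theorem mul_concat (f g : WordSeries) (c : Bool) (w : List Bool) :
    (f * g) (w ++ [c]) = (f * rightDeriv c g) w + f (w ++ [c]) * g [] := by
  induction w generalizing f with
  | nil => simp [mul_cons, leftDeriv, rightDeriv]
  | cons d w ih =>
    simp only [List.cons_append, mul_cons, ih]
    simp only [leftDeriv, rightDeriv]
    ring_nf
    rfl

/-- Reverse a word and exchange its letters. -/
def mirror (w : List Bool) : List Bool := (w.map not).reverse

@[simp] theorem mirror_nil : mirror [] = [] := rfl
@[simp] theorem mirror_cons (c : Bool) (w : List Bool) :
    mirror (c :: w) = mirror w ++ [!c] := by simp [mirror]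
@[simp] theorem mirror_append (u v : List Bool) : mirror (u ++ v) = mirror v ++ mirror u := by
  simp [mirror]
@[simp] theorem mirror_replicate (k : ℕ) (c : Bool) :
    mirror (List.replicate k c) = List.replicate k (!c) := by simp [mirror]
@[simp] theorem mirror_mirror (w : List Bool) : mirror (mirror w) = w := by
  induction w with
  | nil => rfl
  | cons c w ih => simp [ih]
@[simp] theorem length_mirror (w : List Bool) : (mirror w).length = w.length := by simp [mirror]

/-- The anti-involution of the ring of series induced by `mirror`. -/
def rev : WordSeries →+ WordSeries where
  toFun f := fun w => f (mirror w)
  map_zero' := rfl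
  map_add' _ _ := rfl

theorem rev_apply (f : WordSeries) (w : List Bool) : rev f w = f (mirror w) := rfl

@[simp] theorem rev_rev (f : WordSeries) : rev (rev f) = f := by
  ext w; simp [rev_apply]

@[simp] theorem rev_mul (f g : WordSeries) : rev (f * g) = rev g * rev f := by
  ext w
  induction w generalizing g with
  | nil => simp [rev_apply, mul_comm]
  | cons c w ih =>
    have hd : rev (rightDeriv (!c) g) = leftDeriv c (rev g) := by
      ext u; simp [rev_apply, leftDeriv, rightDeriv]
    have h := ih (rightDeriv (!c) g)
    rw [hd, rev_apply] at h
    rw [rev_apply, mirror_cons, mul_concat, h, mul_cons, rev_apply, rev_apply,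
      mirror_cons, mirror_nil, add_comm, mul_comm]

@[simp] theorem rev_one : rev 1 = 1 := by
  ext w
  cases w <;> simp [rev_apply, one_apply]

@[simp] theorem rev_letter (c : Bool) : rev (letter c) = letter (!c) := by
  ext w
  rw [rev_apply, letter, letter]
  congr 1
  rw [eq_iff_iff]
  refine ⟨fun h => ?_, fun h => ?_⟩
  · rw [← mirror_mirror w, h]; simp
  · rw [h]; simp

@[simp] theorem rev_pow (f : WordSeries) (k : ℕ) : rev (f ^ k) = rev f ^ k := by
  induction k with
  | zero => simp
  | succ k ih => rw [pow_succ, rev_mul, ih, pow_succ']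

/-- The series `f` vanishes on all words of length less than `n`. -/
def OrderGe (n : ℕ) (f : WordSeries) : Prop := ∀ w : List Bool, w.length < n → f w = 0

theorem OrderGe.mono {m n : ℕ} {f : WordSeries} (h : OrderGe n f) (hmn : m ≤ n) : OrderGe m f :=
  fun w hw => h w (hw.trans_le hmn)

theorem orderGe_zero (f : WordSeries) : OrderGe 0 f := fun _ h => absurd h (Nat.not_lt_zero _)

theorem OrderGe.add {n : ℕ} {f g : WordSeries} (hf : OrderGe n f) (hg : OrderGe n g) :
    OrderGe n (f + g) := fun w hw => by simp [hf w hw, hg w hw]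

theorem OrderGe.zsmul {n : ℕ} {f : WordSeries} (hf : OrderGe n f) (a : ℤ) :
    OrderGe n (a • f) := fun w hw => by simp [hf w hw]

theorem OrderGe.neg_sub {n : ℕ} {f g : WordSeries} (hf : OrderGe n (f - g)) :
    OrderGe n (g - f) := fun w hw => by
  have := hf w hw
  simp only [sub_apply] at *
  omega

theorem OrderGe.trans {n : ℕ} {f g h : WordSeries} (hf : OrderGe n (f - g))
    (hg : OrderGe n (g - h)) : OrderGe n (f - h) := by
  simpa using hf.add hg

theorem OrderGe.sum {ι : Type*} {s : Finset ι} {n : ℕ} {f : ι → WordSeries}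
    (h : ∀ i ∈ s, OrderGe n (f i)) : OrderGe n (∑ i ∈ s, f i) := fun w hw => by
  rw [sum_apply]
  exact Finset.sum_eq_zero fun i hi => h i hi w hw

theorem OrderGe.mul {m n : ℕ} {f g : WordSeries} (hf : OrderGe m f) (hg : OrderGe n g) :
    OrderGe (m + n) (f * g) := by
  intro w hw
  induction w generalizing f m with
  | nil =>
    rw [mul_nil]
    rcases Nat.eq_zero_or_pos m with rfl | hm
    · rw [hg [] (by simpa using hw), mul_zero]
    · rw [hf [] (by simpa using hm), zero_mul]
  | cons c w ih =>
    have hd : OrderGe (m - 1) (leftDeriv c f) := fun u hu => hf _ (by simp; omega)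
    rw [mul_cons]
    rcases Nat.eq_zero_or_pos m with rfl | hm
    · rw [hg (c :: w) (by simpa using hw), ih hd (by simp at hw; omega)]
      simp
    · rw [hf [] (by simpa using hm), ih hd (by simp at hw; omega)]
      simp

theorem OrderGe.pow {m : ℕ} {f : WordSeries} (hf : OrderGe m f) (k : ℕ) :
    OrderGe (k * m) (f ^ k) := by
  induction k with
  | zero => simpa using orderGe_zero _
  | succ k ih => rw [pow_succ, Nat.succ_mul]; exact ih.mul hf

theorem OrderGe.rev {n : ℕ} {f : WordSeries} (hf : OrderGe n f) :
    OrderGe n (WordSeries.rev f) := fun w hw => hf _ (by simpa using hw)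

theorem orderGe_letter (c : Bool) : OrderGe 1 (letter c) := fun w hw => by
  have : w = [] := by simpa using hw
  simp [this]

/-- The left quotient of a series by `true ^ k`. -/
def leftQuot (k : ℕ) (f : WordSeries) : WordSeries := fun w => f (List.replicate k true ++ w)

/-- The right quotient of a series by `false ^ k`. -/
def rightQuot (k : ℕ) (f : WordSeries) : WordSeries := fun w => f (w ++ List.replicate k false)

@[simp] theorem leftQuot_zero (f : WordSeries) : leftQuot 0 f = f := rfl

theorem leftQuot_succ (k : ℕ) (f : WordSeries) :
    leftQuot (k + 1) f = leftQuot k (leftDeriv true f) := rfl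

@[simp] theorem leftQuot_add (k : ℕ) (f g : WordSeries) :
    leftQuot k (f + g) = leftQuot k f + leftQuot k g := rfl
@[simp] theorem leftQuot_sub (k : ℕ) (f g : WordSeries) :
    leftQuot k (f - g) = leftQuot k f - leftQuot k g := rfl
@[simp] theorem rightQuot_sub (k : ℕ) (f g : WordSeries) :
    rightQuot k (f - g) = rightQuot k f - rightQuot k g := rfl
@[simp] theorem leftQuot_zsmul (k : ℕ) (a : ℤ) (f : WordSeries) :
    leftQuot k (a • f) = a • leftQuot k f := rfl
theorem leftQuot_sum {ι : Type*} (k : ℕ) (s : Finset ι) (f : ι → WordSeries) :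
    leftQuot k (∑ i ∈ s, f i) = ∑ i ∈ s, leftQuot k (f i) := by
  ext w
  simp [sum_apply, leftQuot]

theorem leftQuot_one (k : ℕ) : leftQuot k 1 = if k = 0 then 1 else 0 := by
  ext w
  by_cases h : k = 0 <;> simp [leftQuot, one_apply, h]

@[simp] theorem rev_leftQuot (k : ℕ) (f : WordSeries) :
    rev (leftQuot k f) = rightQuot k (rev f) := by
  ext w; simp [rev_apply, leftQuot, rightQuot]

@[simp] theorem rev_rightQuot (k : ℕ) (f : WordSeries) :
    rev (rightQuot k f) = leftQuot k (rev f) := by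
  ext w; simp [rev_apply, leftQuot, rightQuot]

theorem leftQuot_rightQuot (k j : ℕ) (f : WordSeries) :
    leftQuot k (rightQuot j f) = rightQuot j (leftQuot k f) := by
  ext w; simp [leftQuot, rightQuot]

theorem OrderGe.leftQuot {n : ℕ} {f : WordSeries} (hf : OrderGe n f) (k : ℕ) :
    OrderGe (n - k) (leftQuot k f) := fun w hw => hf _ (by simp; omega)

theorem OrderGe.rightQuot {n : ℕ} {f : WordSeries} (hf : OrderGe n f) (k : ℕ) :
    OrderGe (n - k) (rightQuot k f) := fun w hw => hf _ (by simp; omega)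

theorem leftQuot_mul_letter_false (k : ℕ) (f g : WordSeries) :
    leftQuot k (f * (letter false * g)) = leftQuot k f * (letter false * g) := by
  induction k generalizing f with
  | zero => rfl
  | succ k ih =>
    rw [leftQuot_succ, leftQuot_succ, leftDeriv_mul, leftDeriv_letter_mul]
    simp [ih]

theorem leftQuot_mul_letter_true (k : ℕ) (f g : WordSeries) :
    leftQuot k (f * (letter true * g)) = leftQuot k f * (letter true * g) +
      ∑ i ∈ Finset.range k, f (List.replicate i true) • leftQuot (k - 1 - i) g := by
  induction k generalizing f with
  | zero => simp
  | succ k ih =>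
    rw [leftQuot_succ, leftQuot_succ, leftDeriv_mul, leftDeriv_letter_mul, Finset.sum_range_succ',
      leftQuot_add, ih, if_pos rfl, leftQuot_zsmul, add_comm, add_assoc]
    congr 2
    refine Finset.sum_congr rfl fun i hi => ?_
    rw [show k + 1 - 1 - (i + 1) = k - 1 - i by omega]
    rfl

/-- The series of the letter `true`. -/
abbrev up : WordSeries := letter true

/-- The series of the letter `false`. -/
abbrev dn : WordSeries := letter false

theorem rev_up : rev up = dn := rev_letter true
theorem rev_dn : rev dn = up := rev_letter false

theorem rev_sum {ι : Type*} (s : Finset ι) (f : ι → WordSeries) :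
    rev (∑ i ∈ s, f i) = ∑ i ∈ s, rev (f i) := map_sum rev f s

theorem rev_zsmul (a : ℤ) (f : WordSeries) : rev (a • f) = a • rev f := map_zsmul rev a f

/-- The sum over `k < N` of the contributions of `(F * up) ^ k * F`, followed by a down step and
by the left quotient of `H` by `true ^ k`. -/
def partialSum (N : ℕ) (F H : WordSeries) : WordSeries :=
  ∑ k ∈ Finset.range N, (F * up) ^ k * (F * (dn * leftQuot k H))

theorem partialSum_add_tail {F : WordSeries} {A : ℕ → WordSeries}
    (hA : ∀ k, A k = F * (dn * leftQuot k F) + F * (up * A (k + 1))) (N : ℕ) :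
    A 0 = partialSum N F F + (F * up) ^ N * A N := by
  induction N with
  | zero => simp [partialSum]
  | succ N ih =>
    rw [ih, partialSum, partialSum, Finset.sum_range_succ, pow_succ]
    nth_rewrite 1 [hA N]
    noncomm_ring

theorem orderGe_mul_up (F : WordSeries) : OrderGe 1 (F * up) := by
  simpa using (orderGe_zero F).mul (orderGe_letter true)

theorem orderGe_dn_mul (F : WordSeries) : OrderGe 1 (dn * F) := by
  simpa using (orderGe_letter false).mul (orderGe_zero F)

theorem orderGe_mul_up_pow (F : WordSeries) (k : ℕ) : OrderGe k ((F * up) ^ k) := by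
  simpa using (orderGe_mul_up F).pow k

theorem orderGe_dn_mul_pow (F : WordSeries) (k : ℕ) : OrderGe k ((dn * F) ^ k) := by
  simpa using (orderGe_dn_mul F).pow k

theorem OrderGe.mul_left {n : ℕ} {f : WordSeries} (hf : OrderGe n f) (g : WordSeries) :
    OrderGe n (g * f) := by
  simpa using (orderGe_zero g).mul hf

theorem OrderGe.mul_right {n : ℕ} {f : WordSeries} (hf : OrderGe n f) (g : WordSeries) :
    OrderGe n (f * g) := by
  simpa using hf.mul (orderGe_zero g)

theorem OrderGe.partialSum_sub {n : ℕ} {H H' : WordSeries} (h : OrderGe n (H - H'))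
    (N : ℕ) (F : WordSeries) : OrderGe n (partialSum N F H - partialSum N F H') := by
  rw [partialSum, partialSum, ← Finset.sum_sub_distrib]
  refine OrderGe.sum fun k _ => ?_
  rw [← mul_sub, ← mul_sub, ← mul_sub, ← leftQuot_sub]
  exact ((orderGe_mul_up_pow F k).mul
    (((h.leftQuot k).mul_left dn).mul_left F)).mono (by omega)

theorem leftQuot_mirror_expansion {G : WordSeries} {N k : ℕ} (hk : k < N)
    (hG : ∀ i j, i ≠ j → G (List.replicate i true ++ List.replicate j false) = 0) :
    leftQuot k (1 + ∑ j ∈ Finset.range N,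
        rightQuot j G * (up * (G * ((dn * G) ^ j * dn)))) =
      (if k = 0 then 1 else 0) +
      ∑ j ∈ Finset.range N, leftQuot k (rightQuot j G) * (up * (G * ((dn * G) ^ j * dn))) +
      ∑ i ∈ Finset.range k, G (List.replicate i true ++ List.replicate i false) •
        (leftQuot (k - 1 - i) G * ((dn * G) ^ i * dn)) := by
  rw [leftQuot_add, leftQuot_one, leftQuot_sum, add_assoc]
  congr 1
  simp only [leftQuot_mul_letter_true, Finset.sum_add_distrib]
  congr 1
  rw [Finset.sum_comm]
  refine Finset.sum_congr rfl fun i hi => ?_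
  rw [Finset.mem_range] at hi
  rw [Finset.sum_eq_single_of_mem i (Finset.mem_range.2 (by omega))]
  · rw [mul_pow_mul, leftQuot_mul_letter_false]
    rfl
  · intro j _ hj
    rw [show rightQuot j G (List.replicate i true) = 0 from hG i j hj.symm, zero_zsmul]

theorem sum_range_triangle {M : Type*} [AddCommMonoid M] (N : ℕ) (f : ℕ → ℕ → M) :
    ∑ k ∈ Finset.range N, ∑ i ∈ Finset.range k, f i (k - 1 - i) =
      ∑ i ∈ Finset.range N, ∑ l ∈ Finset.range (N - 1 - i), f i l := by
  rw [Finset.sum_sigma', Finset.sum_sigma']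
  refine Finset.sum_bij' (fun p _ => ⟨p.2, p.1 - 1 - p.2⟩) (fun p _ => ⟨p.1 + 1 + p.2, p.1⟩)
    ?_ ?_ ?_ ?_ ?_ <;> rintro ⟨a, b⟩ h <;> simp only [Finset.mem_sigma, Finset.mem_range] at h ⊢
  · omega
  · omega
  · congr 1; omega
  · congr 1; omega

/-- The terms of the double expansion in which the two distinguished steps do not cross. -/
def mainTerm (N : ℕ) (F G : WordSeries) : WordSeries :=
  ∑ k ∈ Finset.range N, ∑ j ∈ Finset.range N,
    (F * up) ^ k * (F * (dn * (leftQuot k (rightQuot j G) * (up * (G * ((dn * G) ^ j * dn))))))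

/-- The terms of the double expansion in which the two distinguished steps cross. -/
def crossTerm (N : ℕ) (F G : WordSeries) (P : ℕ → WordSeries) : WordSeries :=
  ∑ i ∈ Finset.range N, G (List.replicate i true ++ List.replicate i false) •
    ((F * up) ^ (i + 1) * P i * ((dn * G) ^ i * dn))

theorem partialSum_mirror_expansion {F G : WordSeries} {N : ℕ} (hN : 0 < N)
    (hG : ∀ i j, i ≠ j → G (List.replicate i true ++ List.replicate j false) = 0) :
    partialSum N F (1 + ∑ j ∈ Finset.range N,
        rightQuot j G * (up * (G * ((dn * G) ^ j * dn)))) =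
      F * dn + mainTerm N F G + crossTerm N F G fun i => partialSum (N - 1 - i) F G := by
  have hsum : partialSum N F (1 + ∑ j ∈ Finset.range N,
        rightQuot j G * (up * (G * ((dn * G) ^ j * dn)))) =
      ∑ k ∈ Finset.range N, (F * up) ^ k * (F * (dn * ((if k = 0 then 1 else 0) +
      ∑ j ∈ Finset.range N, leftQuot k (rightQuot j G) * (up * (G * ((dn * G) ^ j * dn))) +
      ∑ i ∈ Finset.range k, G (List.replicate i true ++ List.replicate i false) •
        (leftQuot (k - 1 - i) G * ((dn * G) ^ i * dn))))) :=
    Finset.sum_congr rfl fun k hk => by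
      rw [leftQuot_mirror_expansion (Finset.mem_range.1 hk) hG]
  rw [hsum]
  simp only [mul_add, Finset.sum_add_distrib]
  congr 1
  · congr 1
    · rw [Finset.sum_eq_single_of_mem 0 (Finset.mem_range.2 hN)]
      · simp
      · intro k _ hk
        simp [hk]
    · simp only [mainTerm, Finset.mul_sum]
  · have h := sum_range_triangle N fun i l =>
      G (List.replicate i true ++ List.replicate i false) •
        ((F * up) ^ (i + 1 + l) * (F * (dn * (leftQuot l G * ((dn * G) ^ i * dn)))))
    simp only [crossTerm, partialSum, Finset.mul_sum, Finset.sum_mul, Finset.smul_sum]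
    refine Eq.trans ?_ (h.trans ?_)
    · refine Finset.sum_congr rfl fun k _ => Finset.sum_congr rfl fun i hi => ?_
      rw [Finset.mem_range] at hi
      rw [show i + 1 + (k - 1 - i) = k by omega]
      simp only [mul_smul_comm]
    · refine Finset.sum_congr rfl fun i _ => Finset.sum_congr rfl fun l _ => ?_
      rw [pow_add _ (i + 1) l]
      simp only [mul_assoc]

theorem rev_mul_mainTerm (N : ℕ) (F : WordSeries) :
    rev (up * mainTerm N F (rev F)) = up * ∑ k ∈ Finset.range N, ∑ j ∈ Finset.range N,
      (F * up) ^ k * (F * (dn * (leftQuot k (rightQuot j F) *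
        (up * (rev F * ((dn * rev F) ^ j * dn)))))) := by
  rw [mainTerm, Finset.sum_comm]
  simp only [Finset.mul_sum, rev_sum, rev_mul, rev_pow, rev_up, rev_dn, rev_rev, rev_leftQuot,
    rev_rightQuot, leftQuot_rightQuot]
  refine Finset.sum_congr rfl fun k _ => Finset.sum_congr rfl fun j _ => ?_
  have h : up * (F * up) ^ k = (up * F) ^ k * up := (mul_pow_mul up F k).symm
  simp only [← mul_assoc, h]

/-- A series satisfying the first-step recursion is invariant under reversal. -/
theorem rev_eq_self_of_recursion {F : WordSeries} {A : ℕ → WordSeries} (hF : F = 1 + up * A 0)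
    (hA : ∀ k, A k = F * (dn * leftQuot k F) + F * (up * A (k + 1)))
    (hbal : ∀ i j, i ≠ j → F (List.replicate i true ++ List.replicate j false) = 0) :
    rev F = F := by
  set G := rev F with hGdef
  have hG : ∀ i j, i ≠ j → G (List.replicate i true ++ List.replicate j false) = 0 := by
    intro i j hij
    rw [hGdef, rev_apply, mirror_append, mirror_replicate, mirror_replicate]
    exact hbal j i hij.symm
  have hsub : ∀ N, OrderGe N (A 0 - partialSum N F F) := fun N => by
    rw [partialSum_add_tail hA N, add_sub_cancel_left]
    exact (orderGe_mul_up_pow F N).mul_right _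
  have key : ∀ n, OrderGe n (F - G) := by
    intro n
    induction n with
    | zero => exact orderGe_zero _
    | succ n ih =>
      set G' := 1 + ∑ j ∈ Finset.range (n + 1), rightQuot j G * (up * (G * ((dn * G) ^ j * dn)))
        with hG'
      have hGG' : OrderGe n (G - G') := by
        have h1 : G = 1 + rev (A 0) * dn := by
          rw [hGdef, hF, map_add, rev_one, rev_mul, rev_up]
        have h2 : G' = 1 + rev (partialSum (n + 1) F F) * dn := by
          rw [hG', partialSum, rev_sum, Finset.sum_mul]
          congr 1
          refine Finset.sum_congr rfl fun j _ => ?_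
          simp only [rev_mul, rev_pow, rev_up, rev_dn, rev_leftQuot, ← hGdef, mul_assoc]
        have h3 : G - G' = rev (A 0 - partialSum (n + 1) F F) * dn := by
          rw [h2, map_sub, sub_mul]
          nth_rewrite 1 [h1]
          abel
        rw [h3]
        exact ((hsub (n + 1)).rev.mul_right dn).mono (by omega)
      have hP : ∀ N m, m ≤ N → m ≤ n → OrderGe m (A 0 - partialSum N F G) := fun N m h1 h2 =>
        ((hsub N).mono h1).trans ((ih.partialSum_sub N F).mono h2)
      have hexp : OrderGe n (A 0 - (F * dn + mainTerm (n + 1) F G +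
          crossTerm (n + 1) F G fun _ => A 0)) := by
        refine (hP (n + 1) n (by omega) le_rfl).trans
          ((hGG'.partialSum_sub (n + 1) F).trans ?_)
        rw [hG', partialSum_mirror_expansion n.succ_pos hG, add_sub_add_left_eq_sub, crossTerm,
          crossTerm, ← Finset.sum_sub_distrib]
        refine OrderGe.sum fun i hi => ?_
        rw [Finset.mem_range] at hi
        rw [← zsmul_sub, ← sub_mul, ← mul_sub]
        refine OrderGe.zsmul ?_ _
        exact (((orderGe_mul_up_pow F (i + 1)).mul
          (hP (n + 1 - 1 - i) (n - i) (by omega) (by omega)).neg_sub).mul_right _).mono (by omega)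
      have hcross : crossTerm (n + 1) F G (fun _ => A 0) = ∑ i ∈ Finset.range (n + 1),
          G (List.replicate i true ++ List.replicate i false) •
            ((F * up) ^ i * (F * (F - 1)) * ((dn * G) ^ i * dn)) := by
        refine Finset.sum_congr rfl fun i _ => ?_
        have : F - 1 = up * A 0 := by nth_rewrite 1 [hF]; abel
        rw [this, pow_succ]
        simp only [mul_assoc]
      set W := up * (F * dn + mainTerm (n + 1) F G + crossTerm (n + 1) F G fun _ => A 0) with hW
      have hAW : OrderGe (n + 1) (up * A 0 - W) := by
        rw [hW, ← mul_sub]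
        exact ((orderGe_letter true).mul hexp).mono (by omega)
      have hrevcross : rev (up * crossTerm (n + 1) F G fun _ => A 0) =
          up * ∑ i ∈ Finset.range (n + 1),
          G (List.replicate i true ++ List.replicate i false) •
            ((F * up) ^ i * ((G - 1) * G) * ((dn * G) ^ i * dn)) := by
        rw [hcross]
        simp only [Finset.mul_sum, rev_sum, rev_mul, rev_zsmul, mul_smul_comm]
        refine Finset.sum_congr rfl fun i _ => ?_
        simp only [rev_mul, rev_pow, rev_up, rev_dn, map_sub, rev_one, hGdef, rev_rev]
        congr 1
        have h : up * (F * up) ^ i = (up * F) ^ i * up := (mul_pow_mul up F i).symm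
        rw [← hGdef]
        simp only [← mul_assoc, h]
      have hWW : OrderGe (n + 1) (W - rev W) := by
        have hsplit : W - rev W = up * ((F - G) * dn) +
            (up * mainTerm (n + 1) F G - rev (up * mainTerm (n + 1) F G)) +
            (up * (crossTerm (n + 1) F G fun _ => A 0) -
              rev (up * crossTerm (n + 1) F G fun _ => A 0)) := by
          rw [hW]
          simp only [mul_add, map_add]
          rw [rev_mul up (F * dn), rev_mul, rev_up, rev_dn, ← hGdef]
          noncomm_ring
        rw [hsplit]
        refine OrderGe.add (OrderGe.add ?_ ?_) ?_
        · exact ((orderGe_letter true).mul (ih.mul_right dn)).mono (by omega)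
        · rw [hGdef, rev_mul_mainTerm, ← hGdef, ← mul_sub, mainTerm, ← Finset.sum_sub_distrib]
          refine ((orderGe_letter true).mul (n := n) (OrderGe.sum fun k _ => ?_)).mono (by omega)
          rw [← Finset.sum_sub_distrib]
          refine OrderGe.sum fun j _ => ?_
          rw [← mul_sub, ← mul_sub, ← mul_sub, ← sub_mul, ← leftQuot_sub, ← rightQuot_sub]
          exact ((orderGe_mul_up_pow F k).mul (((((ih.neg_sub.rightQuot j).leftQuot k).mul
            ((((orderGe_dn_mul_pow G j).mul_right dn).mul_left G).mul_left up)).mul_left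
              dn).mul_left F)).mono (by omega)
        · rw [hrevcross, hcross, ← mul_sub, ← Finset.sum_sub_distrib]
          refine ((orderGe_letter true).mul (n := n) (OrderGe.sum fun i _ => ?_)).mono (by omega)
          rw [← zsmul_sub, ← sub_mul, ← mul_sub]
          refine OrderGe.zsmul (OrderGe.mul_right (OrderGe.mul_left ?_ _) _) _
          rw [show F * (F - 1) - (G - 1) * G = F * (F - G) + (F - G) * G - (F - G) by noncomm_ring,
            sub_eq_add_neg, ← neg_one_zsmul]
          exact ((ih.mul_left F).add (ih.mul_right G)).add (ih.zsmul _)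
      have hFG : F - G = (up * A 0 - W) + (W - rev W) + rev (W - up * A 0) := by
        have h1 : G = 1 + rev (up * A 0) := by rw [hGdef, hF, map_add, rev_one]
        rw [h1, map_sub]
        nth_rewrite 1 [hF]
        abel
      rw [hFG]
      exact (hAW.add hWW).add hAW.neg_sub.rev
  ext w
  have := key (w.length + 1) w (Nat.lt_succ_self _)
  rw [sub_apply] at this
  omega

end WordSeries

/-- Binary trees, encoding the relative order of a sequence that avoids 213. -/
inductive PatTree : Type
  | nil : PatTree
  | node : PatTree → PatTree → PatTree

namespace PatTree

open WordSeries

/-- The trees of the 213-avoiding sequences obtained by appending one entry. -/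
def grow : PatTree → List PatTree
  | nil => [node nil nil]
  | node a nil => node a (node nil nil) :: (grow a).map fun t => node t nil
  | node a (node c d) => (grow (node c d)).map (node a)

/-- The tree of the sequence obtained by deleting the smallest entry. -/
def shrink : PatTree → PatTree
  | nil => nil
  | node a nil => a
  | node a (node c d) => node a (shrink (node c d))

/-- The number of ways to reach the empty tree by a word of appendings and deletions. -/
def walks : List Bool → PatTree → ℕ
  | [], nil => 1
  | [], node _ _ => 0
  | true :: w, t => ((grow t).map (walks w)).sum
  | false :: _, nil => 0
  | false :: w, node a c => walks w (shrink (node a c))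

/-- The number of nodes. -/
def size : PatTree → ℕ
  | nil => 0
  | node a c => size a + size c + 1

theorem size_of_mem_grow {t t' : PatTree} (h : t' ∈ grow t) : t'.size = t.size + 1 := by
  induction t using grow.induct generalizing t' with
  | case1 => simp_all [grow, size]
  | case2 a ih =>
    simp only [grow, List.mem_cons, List.mem_map] at h
    rcases h with rfl | ⟨s, hs, rfl⟩
    · simp [size]
    · simp [size, ih hs]
  | case3 a c d ih =>
    simp only [grow, List.mem_map] at h
    obtain ⟨s, hs, rfl⟩ := h
    simp only [size, ih hs]
    omega

theorem size_shrink (a c : PatTree) : (shrink (node a c)).size = a.size + c.size := by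
  induction c generalizing a with
  | nil => simp [shrink, size]
  | node c d _ ih => simp only [shrink, size, ih]; omega

theorem size_add_count_of_walks_ne_zero {w : List Bool} {t : PatTree} (h : walks w t ≠ 0) :
    t.size + w.count true = w.count false := by
  induction w generalizing t with
  | nil => cases t <;> simp_all [walks, size]
  | cons b w ih =>
    cases b
    · cases t with
      | nil => simp [walks] at h
      | node a c =>
        rw [walks] at h
        have := ih h
        rw [size_shrink] at this
        simp [size]
        omega
    · rw [walks] at h
      obtain ⟨s, hs, hs'⟩ : ∃ s ∈ grow t, walks w s ≠ 0 := by
        by_contra! hall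
        exact h (List.sum_eq_zero (by simpa using hall))
      have := ih hs'
      rw [size_of_mem_grow hs] at this
      simp
      omega

/-- The generating series of the walks from `t` to the empty tree. -/
def series (t : PatTree) : WordSeries := fun w => (walks w t : ℤ)

/-- The sum of the generating series of the trees in a list. -/
def listSeries (L : List PatTree) : WordSeries := (L.map series).sum

theorem listSeries_cons (t : PatTree) (L : List PatTree) :
    listSeries (t :: L) = series t + listSeries L := by simp [listSeries]

theorem listSeries_append (L L' : List PatTree) :
    listSeries (L ++ L') = listSeries L + listSeries L' := by simp [listSeries]

@[simp] theorem listSeries_nil : listSeries [] = 0 := rfl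

theorem listSeries_apply (L : List PatTree) (w : List Bool) :
    listSeries L w = ((L.map (walks w)).sum : ℕ) := by
  induction L with
  | nil => rfl
  | cons t L ih => rw [listSeries_cons, add_apply, ih]; simp [series]

theorem leftDeriv_true_series (t : PatTree) : leftDeriv true (series t) = listSeries (grow t) := by
  ext w
  rw [listSeries_apply]
  simp only [leftDeriv, series, walks]

theorem leftDeriv_false_series_nil : leftDeriv false (series nil) = 0 := by
  ext w
  simp [leftDeriv, series, walks]

theorem leftDeriv_false_series_node (a c : PatTree) :
    leftDeriv false (series (node a c)) = series (shrink (node a c)) := by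
  ext w
  simp [leftDeriv, series, walks]

theorem series_nil_nil : series nil [] = 1 := rfl
theorem series_node_nil (a c : PatTree) : series (node a c) [] = 0 := rfl

/-- The walks from `node a nil` whose first step is not the creation of a right child. -/
def nextSeries (a : PatTree) : WordSeries :=
  dn * series a + up * listSeries ((grow a).map fun t => node t nil)

theorem series_node (a c : PatTree) : series (node a c) = series c * nextSeries a := by
  ext w
  induction w generalizing c with
  | nil => simp [nextSeries, series_node_nil]
  | cons b w ih =>
    have hL : ∀ L : List PatTree,
        listSeries (L.map (node a)) w = (listSeries L * nextSeries a) w := by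
      intro L
      induction L with
      | nil => simp
      | cons t L ihL =>
        rw [List.map_cons, listSeries_cons, listSeries_cons, add_mul, add_apply, add_apply, ih, ihL]
    rw [mul_cons]
    cases b
    · change leftDeriv false (series (node a c)) w = _ * leftDeriv false (nextSeries a) w + _
      have hnext : leftDeriv false (nextSeries a) = series a := by
        simp [nextSeries, leftDeriv_letter_mul]
      rw [hnext, leftDeriv_false_series_node]
      cases c with
      | nil => simp [shrink, series_nil_nil, leftDeriv_false_series_nil]
      | node c d =>
        rw [shrink, ih, leftDeriv_false_series_node, series_node_nil]
        simp
    · change leftDeriv true (series (node a c)) w = _ * leftDeriv true (nextSeries a) w + _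
      have hnext : leftDeriv true (nextSeries a) =
          listSeries ((grow a).map fun t => node t nil) := by
        simp [nextSeries, leftDeriv_letter_mul]
      rw [hnext, leftDeriv_true_series, leftDeriv_true_series, ← hL]
      cases c with
      | nil => simp [grow, series_nil_nil, listSeries_cons, add_comm]
      | node c d => simp [grow, series_node_nil]

/-- The trees obtained from the empty tree by `k` appendings, with multiplicity. -/
def level : ℕ → List PatTree
  | 0 => [nil]
  | k + 1 => (level k).flatMap grow

theorem leftDeriv_true_listSeries (L : List PatTree) :
    leftDeriv true (listSeries L) = listSeries (L.flatMap grow) := by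
  induction L with
  | nil => simp
  | cons t L ih =>
    rw [listSeries_cons, leftDeriv_add, ih, leftDeriv_true_series, List.flatMap_cons,
      listSeries_append]

theorem leftQuot_series_nil (k : ℕ) : leftQuot k (series nil) = listSeries (level k) := by
  induction k with
  | zero => simp [level, listSeries_cons]
  | succ k ih =>
    rw [level, ← leftDeriv_true_listSeries, ← ih]
    ext w
    simp only [leftQuot, leftDeriv, List.replicate_succ']
    simp

theorem listSeries_map_node (L : List PatTree) :
    listSeries (L.map fun t => node t nil) =
      series nil * (dn * listSeries L) +
        series nil * (up * listSeries ((L.flatMap grow).map fun t => node t nil)) := by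
  induction L with
  | nil => simp
  | cons t L ih =>
    rw [List.map_cons, listSeries_cons, ih, series_node, nextSeries, List.flatMap_cons,
      List.map_append, listSeries_append, listSeries_cons]
    noncomm_ring

/-- The number of walks from the empty tree to itself is the same for a word and its mirror. -/
theorem walks_mirror (w : List Bool) : walks (mirror w) nil = walks w nil := by
  have h : rev (series nil) = series nil := by
    refine rev_eq_self_of_recursion
      (A := fun k => listSeries ((level k).map fun t => node t nil)) ?_ (fun k => ?_) ?_
    · ext w
      rcases w with _ | ⟨b, w⟩
      · simp [series_nil_nil, one_apply]
      · rw [add_apply, letter_mul_cons]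
        cases b <;> simp [series, walks, one_apply, level, listSeries_apply, grow]
    · rw [leftQuot_series_nil]
      exact listSeries_map_node (level k)
    · intro i j hij
      by_contra hne
      have := size_add_count_of_walks_ne_zero (t := nil) (w := List.replicate i true ++
        List.replicate j false) (by simpa [series] using hne)
      simp [size, List.count_replicate] at this
      exact hij this
  have hw : (walks (mirror w) nil : ℤ) = walks w nil := congrFun h w
  exact_mod_cast hw

/-- The tree `t` encodes the relative order of the entries of the list `l`. -/
def Codes : PatTree → List ℕ → Prop
  | nil, l => l = []
  | node a c, l => ∃ p la lc, l = p :: (la ++ lc) ∧ (∀ x ∈ la, p < x) ∧ (∀ x ∈ lc, x < p) ∧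
      Codes a la ∧ Codes c lc

theorem eq_nil_of_codes_nil {t : PatTree} (h : Codes t []) : t = nil := by
  cases t with
  | nil => rfl
  | node a c => obtain ⟨p, la, lc, h, -⟩ := h; simp at h

theorem append_inj_of_lt_of_gt {p : ℕ} {la lc la' lc' : List ℕ} (h : la ++ lc = la' ++ lc')
    (ha : ∀ x ∈ la, p < x) (hc : ∀ x ∈ lc, x < p) (ha' : ∀ x ∈ la', p < x)
    (hc' : ∀ x ∈ lc', x < p) : la = la' ∧ lc = lc' := by
  have key : ∀ {l r : List ℕ}, (∀ x ∈ l, p < x) → (∀ x ∈ r, x < p) →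
      (l ++ r).filter (fun x => decide (p < x)) = l := by
    intro l r hl hr
    rw [List.filter_append, List.filter_eq_self.2 (by simpa using hl),
      List.filter_eq_nil_iff.2 (by simpa using fun x hx => (hr x hx).le), List.append_nil]
  have h1 : la = la' := by rw [← key ha hc, h, key ha' hc']
  exact ⟨h1, by simpa [h1] using h⟩

theorem codes_unique {t t' : PatTree} {l : List ℕ} (h : Codes t l) (h' : Codes t' l) :
    t = t' := by
  induction t generalizing t' l with
  | nil => rw [Codes] at h; subst h; exact (eq_nil_of_codes_nil h').symm
  | node a c iha ihc =>
    obtain ⟨p, la, lc, rfl, ha, hc, hta, htc⟩ := h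
    cases t' with
    | nil => simp [Codes] at h'
    | node a' c' =>
      obtain ⟨p', la', lc', heq, ha', hc', hta', htc'⟩ := h'
      obtain ⟨rfl, htail⟩ := List.cons.inj heq
      obtain ⟨rfl, rfl⟩ := append_inj_of_lt_of_gt htail ha hc ha' hc'
      rw [iha hta hta', ihc htc htc']

theorem nodup_of_codes {t : PatTree} {l : List ℕ} (h : Codes t l) : l.Nodup := by
  induction t generalizing l with
  | nil => rw [Codes] at h; simp [h]
  | node a c iha ihc =>
    obtain ⟨p, la, lc, rfl, ha, hc, hta, htc⟩ := h
    refine List.nodup_cons.2 ⟨fun hp => ?_, List.nodup_append.2 ⟨iha hta, ihc htc, ?_⟩⟩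
    · rcases List.mem_append.1 hp with hp | hp
      · exact (ha p hp).false
      · exact (hc p hp).false
    · exact fun x hx y hy => ((hc y hy).trans (ha x hx)).ne'

theorem node_mem_grow_left {a c c' : PatTree} (h : c' ∈ grow c) : node a c' ∈ grow (node a c) := by
  cases c with
  | nil => simp_all [grow]
  | node c d => simpa [grow] using h

theorem node_nil_mem_grow {a a' : PatTree} (h : a' ∈ grow a) : node a' nil ∈ grow (node a nil) := by
  simp [grow, h]

/-- The list `l` has no entries that form the pattern 213 together with a final entry `v`. -/
def NoDescentBelow (v : ℕ) (l : List ℕ) : Prop := l.Pairwise fun a b => ¬(b < a ∧ a < v)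

theorem exists_mem_grow_codes {t : PatTree} {l : List ℕ} {v : ℕ} (h : Codes t l) (hv : v ∉ l)
    (hd : NoDescentBelow v l) : ∃ t' ∈ grow t, Codes t' (l ++ [v]) := by
  induction t generalizing l with
  | nil =>
    rw [Codes] at h
    subst h
    exact ⟨node nil nil, by simp [grow], v, [], [], by simp [Codes]⟩
  | node a c iha ihc =>
    obtain ⟨p, la, lc, rfl, ha, hc, hta, htc⟩ := h
    simp only [List.mem_cons, List.mem_append, not_or] at hv
    rw [NoDescentBelow, List.pairwise_cons, List.pairwise_append] at hd
    rcases lt_or_gt_of_ne hv.1 with hvp | hvp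
    · obtain ⟨c', hc', hcc'⟩ := ihc htc hv.2.2 hd.2.2.1
      refine ⟨node a c', node_mem_grow_left hc', p, la, lc ++ [v], by simp, ha, ?_, hta, hcc'⟩
      intro x hx
      rcases List.mem_append.1 hx with hx | hx
      · exact hc x hx
      · rwa [List.mem_singleton.1 hx]
    · have hlc : lc = [] := List.eq_nil_iff_forall_not_mem.2 fun x hx =>
        hd.1 x (by simp [hx]) ⟨hc x hx, hvp⟩
      subst hlc
      obtain rfl := eq_nil_of_codes_nil htc
      obtain ⟨a', ha', haa'⟩ := iha hta hv.2.1 hd.2.1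
      refine ⟨node a' nil, node_nil_mem_grow ha', p, la ++ [v], [], by simp, ?_, by simp, haa',
        rfl⟩
      intro x hx
      rcases List.mem_append.1 hx with hx | hx
      · exact ha x hx
      · rwa [List.mem_singleton.1 hx]

theorem codes_concat {t' : PatTree} {l : List ℕ} {v : ℕ} (h : Codes t' (l ++ [v])) :
    v ∉ l ∧ NoDescentBelow v l ∧ ∃ t, t' ∈ grow t ∧ Codes t l := by
  induction t' generalizing l with
  | nil => simp [Codes] at h
  | node a c iha ihc =>
    obtain ⟨p, la, lc, heq, ha, hc, hta, htc⟩ := h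
    rcases List.eq_nil_or_concat' lc with rfl | ⟨lc', v', rfl⟩
    · obtain rfl := eq_nil_of_codes_nil htc
      rcases List.eq_nil_or_concat' la with rfl | ⟨la', v', rfl⟩
      · obtain rfl := eq_nil_of_codes_nil hta
        obtain rfl : l = [] := by
          have := congrArg List.length heq
          simp at this
          exact this
        exact ⟨by simp, List.Pairwise.nil, nil, by simp [grow], rfl⟩
      · rw [List.append_nil, ← List.cons_append] at heq
        obtain ⟨rfl, hvv⟩ := List.append_inj' heq rfl
        obtain rfl : v = v' := by simpa using hvv
        obtain ⟨h1, h2, t, ht, htl⟩ := iha hta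
        have hv := ha v (by simp)
        refine ⟨?_, ?_, node t nil, node_nil_mem_grow ht, p, la', [], by simp,
          fun x hx => ha x (by simp [hx]), by simp, htl, rfl⟩
        · simp only [List.mem_cons, not_or]
          exact ⟨by omega, h1⟩
        · refine List.pairwise_cons.2 ⟨fun x hx => ?_, h2⟩
          have := ha x (by simp [hx])
          omega
    · rw [← List.append_assoc, ← List.cons_append] at heq
      obtain ⟨rfl, hvv⟩ := List.append_inj' heq rfl
      obtain rfl : v = v' := by simpa using hvv
      obtain ⟨h1, h2, t, ht, htl⟩ := ihc htc
      have hv := hc v (by simp)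
      refine ⟨?_, ?_, node a t, node_mem_grow_left ht, p, la, lc', rfl, ha,
        fun x hx => hc x (by simp [hx]), hta, htl⟩
      · simp only [List.mem_cons, List.mem_append, not_or]
        exact ⟨by omega, fun hx => by have := ha v hx; omega, h1⟩
      · refine List.pairwise_cons.2 ⟨fun x _ => by omega, List.pairwise_append.2
          ⟨List.pairwise_of_forall_mem_list fun x hx y _ => ?_, h2, fun x hx y _ => ?_⟩⟩ <;>
        · have := ha x hx
          omega

theorem exists_codes_concat_iff {l : List ℕ} {v : ℕ} :
    (∃ t, Codes t (l ++ [v])) ↔ (∃ t, Codes t l) ∧ v ∉ l ∧ NoDescentBelow v l := by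
  constructor
  · rintro ⟨t', h⟩
    obtain ⟨h1, h2, t, -, ht⟩ := codes_concat h
    exact ⟨⟨t, ht⟩, h1, h2⟩
  · rintro ⟨⟨t, ht⟩, h1, h2⟩
    obtain ⟨t', -, h⟩ := exists_mem_grow_codes ht h1 h2
    exact ⟨t', h⟩

theorem exists_eq_concat_of_mem_grow {t t' : PatTree} {m : List ℕ} (ht : t' ∈ grow t)
    (h : Codes t' m) : ∃ l v, m = l ++ [v] ∧ Codes t l := by
  induction t using grow.induct generalizing t' m with
  | case1 =>
    rw [grow, List.mem_singleton] at ht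
    subst ht
    obtain ⟨p, la, lc, rfl, -, -, rfl, rfl⟩ := h
    exact ⟨[], p, rfl, rfl⟩
  | case2 a ih =>
    rw [grow, List.mem_cons, List.mem_map] at ht
    rcases ht with rfl | ⟨s, hs, rfl⟩
    · obtain ⟨p, la, lc, rfl, ha, hc, hta, q, _, _, rfl, -, -, rfl, rfl⟩ := h
      exact ⟨p :: la, q, by simp, p, la, [], by simp, ha, by simp, hta, rfl⟩
    · obtain ⟨p, la, lc, rfl, ha, hc, hta, rfl⟩ := h
      obtain ⟨l, v, rfl, hl⟩ := ih hs hta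
      exact ⟨p :: l, v, by simp, p, l, [], by simp, fun x hx => ha x (by simp [hx]), by simp, hl,
        rfl⟩
  | case3 a c d ih =>
    rw [grow, List.mem_map] at ht
    obtain ⟨s, hs, rfl⟩ := ht
    obtain ⟨p, la, lc, rfl, ha, hc, hta, htc⟩ := h
    obtain ⟨l, v, rfl, hl⟩ := ih hs htc
    exact ⟨p :: (la ++ l), v, by simp, p, la, l, rfl, ha, fun x hx => hc x (by simp [hx]), hta, hl⟩

theorem nodup_grow (t : PatTree) : (grow t).Nodup := by
  induction t using grow.induct with
  | case1 => simp [grow]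
  | case2 a ih =>
    rw [grow, List.nodup_cons]
    exact ⟨by simp, ih.map fun s t h => (node.inj h).1⟩
  | case3 a c d ih =>
    rw [grow]
    exact ih.map fun s t h => (node.inj h).2

theorem mem_right_of_codes_node {p y : ℕ} {c d : PatTree} {la lc : List ℕ}
    (ha : ∀ x ∈ la, p < x) (hc : ∀ x ∈ lc, x < p) (htc : Codes (node c d) lc)
    (hy : y ∈ p :: (la ++ lc)) (hmin : ∀ x ∈ p :: (la ++ lc), y ≤ x) :
    y < p ∧ y ∉ la ∧ y ∈ lc := by
  obtain ⟨q, _, _, rfl, -⟩ := htc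
  have hq := hc q (by simp)
  have hyq := hmin q (by simp)
  have hya : y ∉ la := fun h => by have := ha y h; omega
  refine ⟨by omega, hya, ?_⟩
  simp only [List.mem_cons, List.mem_append] at hy ⊢
  rcases hy with rfl | hy | hy
  · omega
  · exact absurd hy hya
  · exact hy

theorem eq_head_of_min {p y : ℕ} {la : List ℕ} (ha : ∀ x ∈ la, p < x)
    (hy : y ∈ p :: (la ++ [])) (hmin : ∀ x ∈ p :: (la ++ []), y ≤ x) : y = p := by
  have := hmin p (by simp)
  simp only [List.append_nil, List.mem_cons] at hy
  rcases hy with rfl | hy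
  · rfl
  · have := ha y hy
    omega

theorem erase_cons_append {p y : ℕ} {la lc : List ℕ} (hp : y < p) (hla : y ∉ la) :
    (p :: (la ++ lc)).erase y = p :: (la ++ lc.erase y) := by
  rw [List.erase_cons_tail (by simpa using hp.ne'), List.erase_append_right _ hla]

theorem codes_shrink {t : PatTree} {l : List ℕ} {y : ℕ} (h : Codes t l) (hy : y ∈ l)
    (hmin : ∀ x ∈ l, y ≤ x) : Codes (shrink t) (l.erase y) := by
  induction t using shrink.induct generalizing l with
  | case1 => rw [Codes] at h; subst h; simp at hy
  | case2 a =>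
    obtain ⟨p, la, lc, rfl, ha, hc, hta, rfl⟩ := h
    obtain rfl := eq_head_of_min ha hy hmin
    simpa [shrink] using hta
  | case3 a c d ih =>
    obtain ⟨p, la, lc, rfl, ha, hc, hta, htc⟩ := h
    obtain ⟨hp, hla, hlc⟩ := mem_right_of_codes_node ha hc htc hy hmin
    rw [erase_cons_append hp hla, shrink]
    exact ⟨p, la, lc.erase y, rfl, ha, fun x hx => hc x (List.mem_of_mem_erase hx), hta,
      ih htc hlc fun x hx => hmin x (by simp [hx])⟩

theorem exists_codes_of_shrink {t : PatTree} {l : List ℕ} {y : ℕ} (ht : t ≠ nil)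
    (h : Codes (shrink t) l) (hmin : ∀ x ∈ l, y < x) :
    ∃ l', Codes t l' ∧ y ∈ l' ∧ l'.erase y = l := by
  induction t using shrink.induct generalizing l with
  | case1 => exact absurd rfl ht
  | case2 a =>
    exact ⟨y :: l, ⟨y, l, [], by simp, hmin, by simp, h, rfl⟩, by simp, by simp⟩
  | case3 a c d ih =>
    rw [shrink] at h
    obtain ⟨p, la, lc, rfl, ha, hc, hta, htc⟩ := h
    obtain ⟨l', h1, h2, rfl⟩ := ih (by simp) htc fun x hx => hmin x (by simp [hx])
    have hp : y < p := hmin p (by simp)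
    have hla : y ∉ la := fun h => by have := hmin y (by simp [h]); omega
    refine ⟨p :: (la ++ l'), ⟨p, la, l', rfl, ha, fun x hx => ?_, hta, h1⟩, by simp [h2],
      erase_cons_append hp hla⟩
    by_cases hxy : x = y
    · omega
    · exact hc x ((List.mem_erase_of_ne hxy).2 hx)

theorem eq_of_codes_of_erase_eq {t : PatTree} {l l' : List ℕ} {y : ℕ} (h : Codes t l)
    (h' : Codes t l') (hy : y ∈ l) (hy' : y ∈ l') (hmin : ∀ x ∈ l, y ≤ x)
    (hmin' : ∀ x ∈ l', y ≤ x) (heq : l.erase y = l'.erase y) : l = l' := by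
  induction t using shrink.induct generalizing l l' with
  | case1 => rw [Codes] at h; subst h; simp at hy
  | case2 a =>
    obtain ⟨p, la, lc, rfl, ha, hc, hta, rfl⟩ := h
    obtain ⟨p', la', lc', rfl, ha', hc', hta', rfl⟩ := h'
    obtain rfl := eq_head_of_min ha hy hmin
    obtain rfl := eq_head_of_min ha' hy' hmin'
    simpa using heq
  | case3 a c d ih =>
    obtain ⟨p, la, lc, rfl, ha, hc, hta, htc⟩ := h
    obtain ⟨p', la', lc', rfl, ha', hc', hta', htc'⟩ := h'
    obtain ⟨hp, hla, hlc⟩ := mem_right_of_codes_node ha hc htc hy hmin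
    obtain ⟨hp', hla', hlc'⟩ := mem_right_of_codes_node ha' hc' htc' hy' hmin'
    rw [erase_cons_append hp hla, erase_cons_append hp' hla'] at heq
    obtain ⟨rfl, htail⟩ := List.cons.inj heq
    obtain ⟨rfl, hright⟩ := append_inj_of_lt_of_gt htail ha
      (fun x hx => hc x (List.mem_of_mem_erase hx)) ha'
      (fun x hx => hc' x (List.mem_of_mem_erase hx))
    rw [ih htc htc' hlc hlc' (fun x hx => hmin x (by simp [hx]))
      (fun x hx => hmin' x (by simp [hx])) hright]

/-- Starting from the list `l` of pending entries, the word `w` can be followed by appending the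
entries of `m` and deleting the numbers `y, y + 1, ...` in turn, through lists avoiding 213. -/
def Valid : List Bool → List ℕ → ℕ → List ℕ → Prop
  | [], l, _, m => l = [] ∧ m = []
  | true :: w, l, y, m => ∃ v m', m = v :: m' ∧ y ≤ v ∧ (∃ t, Codes t (l ++ [v])) ∧
      Valid w (l ++ [v]) y m'
  | false :: w, l, y, m => y ∈ l ∧ Valid w (l.erase y) (y + 1) m

/-- The pairs of a pending list encoded by `t` and a sequence of entries following `w` from it. -/
def completions (w : List Bool) (t : PatTree) (y : ℕ) : Set (List ℕ × List ℕ) :=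
  {q | Codes t q.1 ∧ (∀ x ∈ q.1, y ≤ x) ∧ Valid w q.1 y q.2}

theorem encard_exists_mem_list {α β : Type*} (L : List α) (hL : L.Nodup) (X : α → Set β)
    (hX : ∀ s t q, q ∈ X s → q ∈ X t → s = t) :
    {q | ∃ t ∈ L, q ∈ X t}.encard = (L.map fun t => (X t).encard).sum := by
  induction L with
  | nil => simp
  | cons t L ih =>
    rw [List.nodup_cons] at hL
    rw [List.map_cons, List.sum_cons, ← ih hL.2, ← Set.encard_union_eq]
    · congr 1
      ext q
      simp
    · rw [Set.disjoint_left]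
      rintro q hq ⟨s, hs, hqs⟩
      exact hL.1 (hX t s q hq hqs ▸ hs)

theorem encard_completions (w : List Bool) (t : PatTree) (y : ℕ) :
    (completions w t y).encard = walks w t := by
  induction w generalizing t y with
  | nil =>
    cases t with
    | nil =>
      have : completions [] nil y = {([], [])} := by
        ext ⟨l, m⟩
        simp only [completions, Codes, Valid, Set.mem_ofPred_eq, Set.mem_singleton_iff,
          Prod.mk.injEq]
        constructor
        · rintro ⟨h, -, -, h'⟩
          exact ⟨h, h'⟩
        · rintro ⟨rfl, rfl⟩
          simp
      rw [this, Set.encard_singleton]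
      rfl
    | node a c =>
      have : completions [] (node a c) y = ∅ := by
        rw [Set.eq_empty_iff_forall_notMem]
        rintro ⟨l, m⟩ ⟨⟨p, la, lc, h, -⟩, -, h', -⟩
        simp only at h h'
        simp [h] at h'
      rw [this, Set.encard_empty]
      rfl
  | cons b w ih =>
    cases b
    · cases t with
      | nil =>
        have : completions (false :: w) nil y = ∅ := by
          rw [Set.eq_empty_iff_forall_notMem]
          rintro ⟨l, m⟩ ⟨h, -, h', -⟩
          simp only [Codes] at h h'
          subst h
          simp at h'
        rw [this, Set.encard_empty]
        rfl
      | node a c =>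
        rw [walks, ← ih (shrink (node a c)) (y + 1)]
        have hinj : Set.InjOn (fun q : List ℕ × List ℕ => (q.1.erase y, q.2))
            (completions (false :: w) (node a c) y) := by
          rintro ⟨l, m⟩ ⟨h1, h2, h3, -⟩ ⟨l', m'⟩ ⟨h1', h2', h3', -⟩ heq
          obtain ⟨heq, rfl⟩ := Prod.mk.inj heq
          rw [show l = l' from eq_of_codes_of_erase_eq h1 h1' h3 h3' h2 h2' heq]
        rw [← hinj.encard_image]
        congr 1
        ext ⟨l, m⟩
        constructor
        · rintro ⟨⟨l', m'⟩, ⟨h1, h2, h3, h4⟩, heq⟩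
          obtain ⟨rfl, rfl⟩ := Prod.mk.inj heq
          refine ⟨codes_shrink h1 h3 h2, fun x hx => ?_, h4⟩
          have hx' := (nodup_of_codes h1).mem_erase_iff.1 hx
          have := h2 x hx'.2
          have := hx'.1
          omega
        · rintro ⟨h1, h2, h3⟩
          obtain ⟨l', h4, h5, h6⟩ := exists_codes_of_shrink (by simp) h1 h2
          refine ⟨(l', m), ⟨h4, fun x hx => ?_, h5, by rw [h6]; exact h3⟩, Prod.ext h6 rfl⟩
          by_cases hxy : x = y
          · exact hxy.ge
          · exact Nat.le_of_succ_le (h2 x (h6 ▸ (List.mem_erase_of_ne hxy).2 hx))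
    · have hinj : Set.InjOn (fun q : List ℕ × List ℕ => (q.1 ++ q.2.take 1, q.2.drop 1))
          (completions (true :: w) t y) := by
        rintro ⟨l, _⟩ ⟨-, -, v, m, rfl, -⟩ ⟨l', _⟩ ⟨-, -, v', m', rfl, -⟩ heq
        obtain ⟨heq, h⟩ := Prod.mk.inj heq
        obtain ⟨rfl, hv⟩ := List.append_inj' heq (by simp)
        simp_all
      rw [walks, ← hinj.encard_image]
      have himg : (fun q : List ℕ × List ℕ => (q.1 ++ q.2.take 1, q.2.drop 1)) ''
          completions (true :: w) t y = {q | ∃ t' ∈ grow t, q ∈ completions w t' y} := by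
        ext ⟨l, m⟩
        constructor
        · rintro ⟨⟨l', _⟩, ⟨h1, h2, v, m', rfl, h3, h4, h5⟩, heq⟩
          obtain ⟨rfl, rfl⟩ := Prod.mk.inj heq
          obtain ⟨-, h6, h7⟩ := exists_codes_concat_iff.1 h4
          obtain ⟨t', ht', h8⟩ := exists_mem_grow_codes h1 h6 h7
          refine ⟨t', ht', h8, fun x hx => ?_, h5⟩
          rcases List.mem_append.1 hx with hx | hx
          · exact h2 x hx
          · rwa [show x = v by simpa using hx]
        · rintro ⟨t', ht', h1, h2, h3⟩
          obtain ⟨l', v, h4, h5⟩ := exists_eq_concat_of_mem_grow ht' h1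
          simp only at h1 h2 h3 h4
          subst h4
          exact ⟨(l', v :: m), ⟨h5, fun x hx => h2 x (by simp [hx]), v, m, rfl,
            h2 v (by simp), ⟨t', h1⟩, h3⟩, rfl⟩
      rw [himg, encard_exists_mem_list _ (nodup_grow t) _
        fun s t q hs ht => codes_unique hs.1 ht.1]
      simp only [ih]
      induction grow t with
      | nil => simp
      | cons s L ihL => simp [ihL]

theorem encard_valid (w : List Bool) : {m | Valid w [] 0 m}.encard = walks w nil := by
  rw [← encard_completions w nil 0,
    ← Function.Injective.encard_image (f := fun m : List ℕ => (([] : List ℕ), m))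
      (fun m m' h => (Prod.mk.inj h).2)]
  congr 1
  ext ⟨l, m⟩
  constructor
  · rintro ⟨m', h, heq⟩
    obtain ⟨rfl, rfl⟩ := Prod.mk.inj heq
    exact ⟨rfl, by simp, h⟩
  · rintro ⟨h, -, h'⟩
    rw [Codes] at h
    simp only at h h'
    subst h
    exact ⟨m, h', rfl⟩

end PatTree

section

open PatTree WordSeries

/-- The set of cells `(x, y)` (column `x`, row `y`) of a Young diagram of size `n` whose rows get
longer going up. -/
structure IsCellSet (n : ℕ) (C : ℕ → ℕ → Prop) : Prop where
  left_lt : ∀ {x y}, C x y → x < n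
  right_lt : ∀ {x y}, C x y → y < n
  mono : ∀ {x y x' y'}, C x y → x' ≤ x → y ≤ y' → y' < n → C x' y'

/-- A lattice path from `(x, y)` to `(x', y')` along the lower right boundary of the diagram with
cells `C`, where `true` is a step to the right and `false` is a step up. -/
inductive BoundaryPath (C : ℕ → ℕ → Prop) : ℕ → ℕ → ℕ → ℕ → List Bool → Prop
  | refl (x y : ℕ) : BoundaryPath C x y x y []
  | right {x y x' y' : ℕ} {w : List Bool} : C x y → (∀ z, y = z + 1 → ¬C x z) →
      BoundaryPath C (x + 1) y x' y' w → BoundaryPath C x y x' y' (true :: w)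
  | up {x y x' y' : ℕ} {w : List Bool} : C x y → ¬C (x + 1) y →
      BoundaryPath C (x + 1) (y + 1) x' y' w → BoundaryPath C (x + 1) y x' y' (false :: w)

namespace BoundaryPath

variable {C : ℕ → ℕ → Prop}

theorem trans {x y x' y' x'' y'' : ℕ} {w w' : List Bool} (h : BoundaryPath C x y x' y' w)
    (h' : BoundaryPath C x' y' x'' y'' w') : BoundaryPath C x y x'' y'' (w ++ w') := by
  induction h with
  | refl => exact h'
  | right h1 h2 _ ih => exact .right h1 h2 (ih h')
  | up h1 h2 _ ih => exact .up h1 h2 (ih h')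

end BoundaryPath

/-- The reflection of a set of cells in the antidiagonal of the `n × n` square. -/
def mirrorCells (n : ℕ) (C : ℕ → ℕ → Prop) (x y : ℕ) : Prop :=
  x < n ∧ y < n ∧ C (n - 1 - y) (n - 1 - x)

theorem IsCellSet.mirrorCells {n : ℕ} {C : ℕ → ℕ → Prop} (hC : IsCellSet n C) :
    IsCellSet n (mirrorCells n C) where
  left_lt h := h.1
  right_lt h := h.2.1
  mono := fun ⟨h1, h2, h3⟩ hx hy hn =>
    ⟨by omega, hn, hC.mono h3 (by omega) (by omega) (by omega)⟩

theorem BoundaryPath.mirror {n : ℕ} {C : ℕ → ℕ → Prop} (hC : IsCellSet n C) {x y x' y' : ℕ}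
    {w : List Bool} (h : BoundaryPath C x y x' y' w) :
    BoundaryPath (mirrorCells n C) (n - y') (n - x') (n - y) (n - x) (mirror w) := by
  induction h with
  | refl => exact .refl _ _
  | @right x y x' y' w h1 h2 _ ih =>
    have hx := hC.left_lt h1
    have hy := hC.right_lt h1
    rw [mirror_cons]
    refine ih.trans ?_
    rw [show n - x = n - (x + 1) + 1 by omega, show n - y = n - 1 - y + 1 by omega]
    refine .up ⟨by omega, by omega, ?_⟩ ?_ (.refl _ _)
    · rwa [show n - 1 - (n - (x + 1)) = x by omega, show n - 1 - (n - 1 - y) = y by omega]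
    · rintro ⟨h3, -, h4⟩
      rw [show n - 1 - (n - (x + 1)) = x by omega] at h4
      exact h2 _ (by omega) h4
  | @up x y x' y' w h1 h2 _ ih =>
    have hx := hC.left_lt h1
    have hy := hC.right_lt h1
    rw [mirror_cons]
    refine ih.trans ?_
    rw [show n - y = n - (y + 1) + 1 by omega]
    refine .right ⟨by omega, by omega, ?_⟩ ?_ (.refl _ _)
    · rwa [show n - 1 - (n - (x + 1)) = x by omega, show n - 1 - (n - (y + 1)) = y by omega]
    · rintro z hz ⟨-, -, h4⟩
      rw [show n - 1 - z = x + 1 by omega, show n - 1 - (n - (y + 1)) = y by omega] at h4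
      exact h2 h4

theorem exists_boundaryPath {n : ℕ} {b : ℕ → ℕ} (hb : IsYoungShape n b) :
    ∃ w, BoundaryPath (fun x y => y < n ∧ x < b y) 0 0 n n w := by
  suffices H : ∀ d x y, d = (n - x) + (n - y) → x ≤ n → y ≤ n → (y < n → x ≤ b y) →
      (y = n → x = n) → (∀ z, y = z + 1 → b z ≤ x) →
      ∃ w, BoundaryPath (fun x y => y < n ∧ x < b y) x y n n w from
    H _ 0 0 rfl (by omega) (by omega) (by omega) (by omega) (by omega)
  intro d
  induction d with
  | zero =>
    intro x y hd hx hy _ _ _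
    obtain rfl : x = n := by omega
    obtain rfl : y = x := by omega
    exact ⟨[], .refl _ _⟩
  | succ d ih =>
    intro x y hd hx hy h1 h2 h3
    have hyn : y < n := by
      by_contra h
      have := h2 (by omega)
      omega
    have hb1 := hb.2 y hyn
    by_cases hxb : x < b y
    · obtain ⟨w, hw⟩ := ih (x + 1) y (by omega) (by omega) hy (by omega) (by omega)
        fun z hz => (h3 z hz).trans (Nat.le_succ x)
      exact ⟨_, .right ⟨hyn, hxb⟩ (fun z hz h => by have := h3 z hz; omega) hw⟩
    · have hxb' := h1 hyn
      obtain ⟨w, hw⟩ := ih x (y + 1) (by omega) hx (by omega)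
        (fun h => hxb'.trans (hb.1 y (y + 1) (by omega) h)) (by omega)
        fun z hz => by obtain rfl : y = z := by omega
                       omega
      obtain ⟨x, rfl⟩ : ∃ x', x = x' + 1 := ⟨x - 1, by omega⟩
      exact ⟨_, .up ⟨hyn, by omega⟩ (fun h => by omega) hw⟩

/-- The values at least `y` of `p` at `0, ..., x - 1`, in order of position. -/
def pending (p : ℕ → ℕ) (x y : ℕ) : List ℕ :=
  ((List.range x).map p).filter fun v => decide (y ≤ v)

section pending

variable {p : ℕ → ℕ} {x y : ℕ}

theorem mem_pending {v : ℕ} : v ∈ pending p x y ↔ (∃ i < x, p i = v) ∧ y ≤ v := by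
  simp [pending]

theorem pending_succ (h : y ≤ p x) : pending p (x + 1) y = pending p x y ++ [p x] := by
  simp [pending, List.range_succ, h]

theorem noDescentBelow_pending {v : ℕ} : NoDescentBelow v (pending p x y) ↔
    ∀ i j, i < j → j < x → y ≤ p j → p j < p i → v ≤ p i := by
  rw [NoDescentBelow, pending, List.pairwise_filter, List.pairwise_map, List.pairwise_iff_getElem]
  simp only [List.length_range, List.getElem_range, decide_eq_true_eq, not_and, not_lt]
  constructor
  · exact fun h i j hij hj hy hp => h i j (hij.trans hj) hj hij (hy.trans hp.le) hy hp
  · exact fun h i j _ hj hij _ hy hp => h i j hij hj hy hp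

theorem erase_pending (hinj : ∀ i < x, ∀ j < x, p i = p j → i = j) :
    (pending p x y).erase y = pending p x (y + 1) := by
  have hnd : (pending p x y).Nodup :=
    (List.nodup_range.map_on fun i hi j hj h =>
      hinj i (List.mem_range.1 hi) j (List.mem_range.1 hj) h).filter _
  rw [hnd.erase_eq_filter, pending, pending, List.filter_filter]
  refine List.filter_congr fun v _ => ?_
  rw [Bool.eq_iff_iff]
  simp only [Bool.and_eq_true, bne_iff_ne, decide_eq_true_eq]
  omega

end pending

theorem valid_pending_iff {n : ℕ} {C : ℕ → ℕ → Prop} (hC : IsCellSet n C) {p : ℕ → ℕ}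
    (hlt : ∀ k < n, p k < n) (hinj : ∀ i < n, ∀ j < n, p i = p j → i = j)
    (hsurj : ∀ y < n, ∃ i < n, p i = y) {x y x' y' : ℕ} {w : List Bool}
    (h : BoundaryPath C x y x' y' w) (hx' : x' = n) (hy' : y' = n)
    (hst : ∃ t, Codes t (pending p x y)) :
    Valid w (pending p x y) y ((List.range' x (n - x)).map p) ↔
      ∀ k, x ≤ k → k < n → C k (p k) ∧
        ∀ i j, i < j → j < k → p j < p i → p i < p k → ¬C k (p j) := by
  induction h with
  | refl x y =>
    obtain rfl : x = y := hx'.trans hy'.symm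
    subst hx'
    have : pending p x x = [] := List.eq_nil_iff_forall_not_mem.2 fun v hv => by
      obtain ⟨⟨i, hi, rfl⟩, h⟩ := mem_pending.1 hv
      have := hlt i hi
      omega
    simp only [Valid, this, Nat.sub_self, List.range'_zero, List.map_nil, and_self, true_iff]
    omega
  | @right x y x' y' w h1 h2 _ ih =>
    have hx := hC.left_lt h1
    have hcell : ∀ v < n, C x v ↔ y ≤ v := by
      refine fun v hv => ⟨fun h => ?_, fun h => hC.mono h1 le_rfl h hv⟩
      by_contra hyv
      obtain ⟨z, rfl⟩ : ∃ z, y = z + 1 := ⟨y - 1, by omega⟩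
      exact h2 z rfl (hC.mono h le_rfl (by omega) (by have := hC.right_lt h1; omega))
    have hnotin : p x ∉ pending p x y := fun h => by
      obtain ⟨⟨i, hi, h⟩, -⟩ := mem_pending.1 h
      have := hinj i (hi.trans hx) x hx h
      omega
    have hrest : (List.range' x (n - x)).map p =
        p x :: (List.range' (x + 1) (n - (x + 1))).map p := by
      rw [show n - x = n - (x + 1) + 1 by omega, List.range'_succ, List.map_cons]
    have hstep : (∃ t, Codes t (pending p x y ++ [p x])) ↔
        ∀ i j, i < j → j < x → p j < p i → p i < p x → ¬C x (p j) := by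
      rw [exists_codes_concat_iff, noDescentBelow_pending]
      constructor
      · rintro ⟨-, -, h⟩ i j hij hj hp hpx hc
        have := h i j hij hj ((hcell _ (hlt j (hj.trans hx))).1 hc) hp
        omega
      · refine fun h => ⟨hst, hnotin, fun i j hij hj hy hp => ?_⟩
        by_contra hpx
        exact h i j hij hj hp (by omega) ((hcell _ (hlt j (hj.trans hx))).2 hy)
    rw [hrest]
    constructor
    · rintro ⟨v, m', heq, h3, h4, h5⟩ k hk hkn
      obtain ⟨rfl, rfl⟩ := List.cons.inj heq
      rcases hk.eq_or_lt with rfl | hk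
      · exact ⟨(hcell _ (hlt x hx)).2 h3, hstep.1 h4⟩
      · rw [← pending_succ h3] at h4 h5
        exact (ih hx' hy' h4).1 h5 k hk hkn
    · intro h
      obtain ⟨h3, h4⟩ := h x le_rfl hx
      rw [hcell _ (hlt x hx)] at h3
      rw [← hstep] at h4
      refine ⟨_, _, rfl, h3, h4, ?_⟩
      rw [← pending_succ h3] at h4 ⊢
      exact (ih hx' hy' h4).2 fun k hk => h k (by omega)
  | @up x y x' y' w h1 h2 _ ih =>
    have hx := hC.left_lt h1
    have herase := erase_pending (p := p) (x := x + 1) (y := y) fun i hi j hj =>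
      hinj i (by omega) j (by omega)
    have hst' : y ∈ pending p (x + 1) y → ∃ t, Codes t (pending p (x + 1) (y + 1)) := fun hy => by
      obtain ⟨t, ht⟩ := hst
      exact ⟨_, herase ▸ codes_shrink ht hy fun v hv => (mem_pending.1 hv).2⟩
    rw [Valid, herase]
    constructor
    · rintro ⟨hy, h⟩
      exact (ih hx' hy' (hst' hy)).1 h
    · intro h
      have hy : y ∈ pending p (x + 1) y := by
        obtain ⟨i, hi, hiy⟩ := hsurj y (hC.right_lt h1)
        refine mem_pending.2 ⟨⟨i, ?_, hiy⟩, le_rfl⟩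
        by_contra hix
        have := (h i (by omega) hi).1
        rw [hiy] at this
        exact h2 (hC.mono this (by omega) le_rfl (hC.right_lt h1))
      exact ⟨hy, (ih hx' hy' (hst' hy)).2 h⟩

theorem perm_of_valid {n : ℕ} {C : ℕ → ℕ → Prop} (hC : IsCellSet n C) {x y x' y' : ℕ}
    {w : List Bool} (h : BoundaryPath C x y x' y' w) (hy' : y' = n) {l m : List ℕ}
    (hv : Valid w l y m) : (l ++ m).Perm (List.range' y (n - y)) := by
  induction h generalizing l m with
  | refl x y =>
    obtain ⟨rfl, rfl⟩ := hv
    simp [hy']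
  | @right x y x' y' w h1 h2 _ ih =>
    obtain ⟨v, m', rfl, -, -, hv⟩ := hv
    simpa using ih hy' hv
  | @up x y x' y' w h1 h2 _ ih =>
    have hy := hC.right_lt h1
    obtain ⟨hyl, hv⟩ := hv
    rw [show n - y = n - (y + 1) + 1 by omega, List.range'_succ]
    exact ((List.perm_cons_erase hyl).append_right m).trans ((ih hy' hv).cons y)

theorem exists_perm_ofFn_eq {n : ℕ} {m : List ℕ} (h : m.Perm (List.range n)) :
    ∃ π : Equiv.Perm (Fin n), List.ofFn (fun i => (π i : ℕ)) = m := by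
  have hlen : m.length = n := by simpa using h.length_eq
  have hnd : m.Nodup := h.nodup_iff.2 List.nodup_range
  subst hlen
  have hinj : Function.Injective fun i : Fin m.length =>
      (⟨m[i], List.mem_range.1 (h.mem_iff.1 (List.getElem_mem i.2))⟩ : Fin m.length) := by
    intro i j hij
    exact Fin.ext (hnd.getElem_inj_iff.1 (Fin.mk.inj hij))
  refine ⟨Equiv.ofBijective _ (Finite.injective_iff_bijective.1 hinj), ?_⟩
  simp

/-- The transversals of a set of cells avoiding the pattern 213. -/
def avoiders213 (n : ℕ) (C : ℕ → ℕ → Prop) : Set (Equiv.Perm (Fin n)) :=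
  {π | (∀ i : Fin n, C i (π i)) ∧
    ∀ i j k : Fin n, i < j → j < k → π j < π i → π i < π k → ¬C k (π j)}

theorem valid_ofFn_iff {n : ℕ} {C : ℕ → ℕ → Prop} (hC : IsCellSet n C) {w : List Bool}
    (hw : BoundaryPath C 0 0 n n w) (π : Equiv.Perm (Fin n)) :
    Valid w [] 0 (List.ofFn fun i => (π i : ℕ)) ↔ π ∈ avoiders213 n C := by
  obtain ⟨p, hp⟩ : ∃ p : ℕ → ℕ, ∀ i : Fin n, p i = π i :=
    ⟨fun k => if h : k < n then π ⟨k, h⟩ else 0, fun i => by simp⟩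
  have hp' : ∀ k (h : k < n), p k = π ⟨k, h⟩ := fun k h => hp ⟨k, h⟩
  have key := valid_pending_iff hC (p := p) (fun k hk => by rw [hp' k hk]; exact Fin.is_lt _)
    (fun i hi j hj h => by
      rw [hp' i hi, hp' j hj] at h
      exact Fin.mk.inj (π.injective (Fin.ext h)))
    (fun y hy => ⟨π.symm ⟨y, hy⟩, Fin.is_lt _, by rw [hp]; simp⟩) hw rfl rfl ⟨nil, rfl⟩
  have hlist : (List.range' 0 (n - 0)).map p = List.ofFn fun i => (π i : ℕ) :=
    List.ext_getElem (by simp) fun i h h' => by simpa using hp' i (by simpa using h)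
  rw [hlist] at key
  refine key.trans ⟨fun h => ⟨fun i => ?_, fun i j k hij hjk h1 h2 => ?_⟩, fun h k _ hk => ?_⟩
  · simpa [hp] using (h i (Nat.zero_le _) i.2).1
  · have := (h k (Nat.zero_le _) k.2).2 i j hij hjk
    rw [hp, hp, hp] at this
    exact this h1 h2
  · refine ⟨by simpa [hp' k hk] using h.1 ⟨k, hk⟩, fun i j hij hjk => ?_⟩
    have := h.2 ⟨i, by omega⟩ ⟨j, by omega⟩ ⟨k, hk⟩ hij hjk
    rw [hp' i (by omega), hp' j (by omega), hp' k hk]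
    exact this

theorem encard_avoiders213 {n : ℕ} {C : ℕ → ℕ → Prop} (hC : IsCellSet n C) {w : List Bool}
    (hw : BoundaryPath C 0 0 n n w) : (avoiders213 n C).encard = walks w nil := by
  have hinj : Function.Injective fun π : Equiv.Perm (Fin n) => List.ofFn fun i => (π i : ℕ) :=
    fun π σ h => Equiv.ext fun i => Fin.ext (congrFun (List.ofFn_injective h) i)
  rw [← encard_valid, ← hinj.encard_image]
  congr 1
  ext m
  constructor
  · rintro ⟨π, hπ, rfl⟩
    exact (valid_ofFn_iff hC hw π).2 hπ
  · intro hm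
    obtain ⟨π, rfl⟩ := exists_perm_ofFn_eq
      (by simpa [List.range_eq_range'] using perm_of_valid hC hw rfl hm)
    exact ⟨π, (valid_ofFn_iff hC hw π).1 hm, rfl⟩

theorem encard_avoiders213_mirrorCells {n : ℕ} {C : ℕ → ℕ → Prop} (hC : IsCellSet n C)
    {w : List Bool} (hw : BoundaryPath C 0 0 n n w) :
    (avoiders213 n (mirrorCells n C)).encard = (avoiders213 n C).encard := by
  have h := hw.mirror hC
  rw [Nat.sub_self, Nat.sub_zero] at h
  rw [encard_avoiders213 hC hw, encard_avoiders213 hC.mirrorCells h, walks_mirror]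

/-- The reflection of a permutation matrix in the antidiagonal. -/
def antitranspose (n : ℕ) : Equiv.Perm (Fin n) ≃ Equiv.Perm (Fin n) where
  toFun π := Fin.revPerm * π⁻¹ * Fin.revPerm
  invFun π := Fin.revPerm * π⁻¹ * Fin.revPerm
  left_inv π := by ext; simp
  right_inv π := by ext; simp

theorem antitranspose_mem_avoiders213 {n : ℕ} {C : ℕ → ℕ → Prop} {π : Equiv.Perm (Fin n)} :
    antitranspose n π ∈ avoiders213 n (mirrorCells n C) ↔ (∀ i : Fin n, C i (π i)) ∧
      ∀ i j k : Fin n, i < j → j < k → π i < π k → π k < π j → ¬C k (π i) := by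
  have hcell : ∀ i k : Fin n, mirrorCells n C (π i).rev k.rev ↔ C k (π i) := by
    intro i k
    have := (π i).2
    have := k.2
    simp only [mirrorCells, Fin.val_rev]
    rw [show n - 1 - (n - (k + 1)) = (k : ℕ) by omega,
      show n - 1 - (n - (π i + 1)) = (π i : ℕ) by omega]
    exact ⟨fun h => h.2.2, fun h => ⟨by omega, by omega, h⟩⟩
  have happ : ∀ i, antitranspose n π (π i).rev = i.rev := fun i => by simp [antitranspose]
  have hsurj : ∀ i, ∃ j, i = (π j).rev := fun i => ⟨π.symm i.rev, by simp⟩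
  constructor
  · rintro ⟨h1, h2⟩
    refine ⟨fun i => (hcell i i).1 (happ i ▸ h1 (π i).rev), fun i j k hij hjk hik hkj hc => ?_⟩
    refine h2 (π j).rev (π k).rev (π i).rev (Fin.rev_lt_rev.2 hkj) (Fin.rev_lt_rev.2 hik) ?_ ?_ ?_
    · rwa [happ, happ, Fin.rev_lt_rev]
    · rwa [happ, happ, Fin.rev_lt_rev]
    · rwa [happ, hcell]
  · rintro ⟨h1, h2⟩
    refine ⟨fun i => ?_, fun i j k hij hjk hji hik hc => ?_⟩
    · obtain ⟨i, rfl⟩ := hsurj i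
      rw [happ, hcell]
      exact h1 i
    · obtain ⟨i, rfl⟩ := hsurj i
      obtain ⟨j, rfl⟩ := hsurj j
      obtain ⟨k, rfl⟩ := hsurj k
      rw [happ, hcell] at hc
      rw [happ, happ, Fin.rev_lt_rev] at hji hik
      exact h2 k i j hik hji (Fin.rev_lt_rev.1 hjk) (Fin.rev_lt_rev.1 hij) hc

theorem isCellSet_of_isYoungShape {n : ℕ} {b : ℕ → ℕ} (hb : IsYoungShape n b) :
    IsCellSet n (fun x y => y < n ∧ x < b y) where
  left_lt h := h.2.trans_le (hb.2 _ h.1).2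
  right_lt h := h.1
  mono h hx hy hn := ⟨hn, (hx.trans_lt h.2).trans_le (hb.1 _ _ hy hn)⟩

theorem shapeContains_three_iff {n : ℕ} {b : ℕ → ℕ} {π : Equiv.Perm (Fin n)}
    {τ : Fin 3 → Fin 3} : ShapeContains n b π τ ↔ ∃ i j k, i < j ∧ j < k ∧
      (∀ a c, τ a < τ c ↔ π (![i, j, k] a) < π (![i, j, k] c)) ∧
      ∀ a c, ((![i, j, k] a : Fin n) : ℕ) < b (π (![i, j, k] c)) := by
  constructor
  · rintro ⟨f, h1, h2⟩
    have hf : ![f 0, f 1, f 2] = f := by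
      ext a
      fin_cases a <;> rfl
    refine ⟨f 0, f 1, f 2, f.lt_iff_lt.2 (by decide), f.lt_iff_lt.2 (by decide), ?_⟩
    rw [hf]
    exact ⟨h1, h2⟩
  · rintro ⟨i, j, k, hij, hjk, h1, h2⟩
    refine ⟨OrderEmbedding.ofStrictMono ![i, j, k] (Fin.strictMono_iff_lt_succ.2 fun a => ?_),
      h1, h2⟩
    fin_cases a
    · exact hij
    · exact hjk

theorem shapeContains_213_iff {n : ℕ} {b : ℕ → ℕ} (hb : IsYoungShape n b)
    {π : Equiv.Perm (Fin n)} : ShapeContains n b π (![1, 0, 2] : Fin 3 → Fin 3) ↔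
      ∃ i j k, i < j ∧ j < k ∧ π j < π i ∧ π i < π k ∧ (k : ℕ) < b (π j) := by
  rw [shapeContains_three_iff]
  refine exists_congr fun i => exists_congr fun j => exists_congr fun k =>
    and_congr_right fun hij => and_congr_right fun hjk => ⟨fun ⟨h1, h2⟩ => ?_, ?_⟩
  · exact ⟨(h1 1 0).1 (by decide), (h1 0 2).1 (by decide), h2 2 1⟩
  · rintro ⟨h1, h2, h3⟩
    have h4 := hb.1 _ _ h1.le (π i).2
    have h5 := hb.1 _ _ (h1.trans h2).le (π k).2
    simp only [Fin.lt_def] at hij hjk h1 h2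
    constructor <;>
    · intro a c
      fin_cases a <;> fin_cases c <;> simp [-Fin.val_fin_lt, Fin.lt_def] <;> omega

theorem shapeContains_132_iff {n : ℕ} {b : ℕ → ℕ} (hb : IsYoungShape n b)
    {π : Equiv.Perm (Fin n)} : ShapeContains n b π (![0, 2, 1] : Fin 3 → Fin 3) ↔
      ∃ i j k, i < j ∧ j < k ∧ π i < π k ∧ π k < π j ∧ (k : ℕ) < b (π i) := by
  rw [shapeContains_three_iff]
  refine exists_congr fun i => exists_congr fun j => exists_congr fun k =>
    and_congr_right fun hij => and_congr_right fun hjk => ⟨fun ⟨h1, h2⟩ => ?_, ?_⟩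
  · exact ⟨(h1 0 2).1 (by decide), (h1 2 1).1 (by decide), h2 2 0⟩
  · rintro ⟨h1, h2, h3⟩
    have h4 := hb.1 _ _ h1.le (π k).2
    have h5 := hb.1 _ _ (h1.trans h2).le (π j).2
    simp only [Fin.lt_def] at hij hjk h1 h2
    constructor <;>
    · intro a c
      fin_cases a <;> fin_cases c <;> simp [-Fin.val_fin_lt, Fin.lt_def] <;> omega

theorem shapeAvoidCard_213 {n : ℕ} {b : ℕ → ℕ} (hb : IsYoungShape n b) :
    shapeAvoidCard n b (![1, 0, 2] : Fin 3 → Fin 3) =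
      (avoiders213 n fun x y => y < n ∧ x < b y).ncard := by
  rw [shapeAvoidCard, ← Nat.card_coe_set_eq]
  refine Nat.card_congr (Equiv.subtypeEquivRight fun π => ?_)
  rw [shapeContains_213_iff hb]
  refine and_congr (by simp [IsTransversal]) ⟨fun h i j k h1 h2 h3 h4 h5 => ?_, fun h => ?_⟩
  · exact h ⟨i, j, k, h1, h2, h3, h4, h5.2⟩
  · rintro ⟨i, j, k, h1, h2, h3, h4, h5⟩
    exact h i j k h1 h2 h3 h4 ⟨(π j).2, h5⟩

theorem shapeAvoidCard_132 {n : ℕ} {b : ℕ → ℕ} (hb : IsYoungShape n b) :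
    shapeAvoidCard n b (![0, 2, 1] : Fin 3 → Fin 3) =
      (avoiders213 n (mirrorCells n fun x y => y < n ∧ x < b y)).ncard := by
  rw [shapeAvoidCard, ← Nat.card_coe_set_eq]
  refine Nat.card_congr ((antitranspose n).subtypeEquiv fun π => ?_)
  rw [shapeContains_132_iff hb, antitranspose_mem_avoiders213]
  refine and_congr (by simp [IsTransversal]) ⟨fun h i j k h1 h2 h3 h4 h5 => ?_, fun h => ?_⟩
  · exact h ⟨i, j, k, h1, h2, h3, h4, h5.2⟩
  · rintro ⟨i, j, k, h1, h2, h3, h4, h5⟩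
    exact h i j k h1 h2 h3 h4 ⟨(π i).2, h5⟩

end

/-- Main result: the patterns 213 and 132 are shape-Wilf-equivalent. -/
theorem swe_213_132 :
    ShapeWilfEquiv (![1,0,2] : Fin 3 → Fin 3) (![0,2,1] : Fin 3 → Fin 3) := by
  intro n b hb
  obtain ⟨w, hw⟩ := exists_boundaryPath hb
  rw [shapeAvoidCard_213 hb, shapeAvoidCard_132 hb, Set.ncard, Set.ncard,
    encard_avoiders213_mirrorCells (isCellSet_of_isYoungShape hb) hw]
end

section
/- For any n ≥ 3 and any permutation τ of {1,...,n−3}, the patterns (n−1, n−2, n, τ(1)+0, ..., τ(n−3)) — i.e., the permutation beginning n−1, n−2, n followed by τ on the values {1,...,n−3} — and (n−2, n, n−1, τ) are Wilf-equivalent: they have equally many avoiding permutations in S_m for every m. -/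
/-- Classical pattern containment: `π` contains the pattern `τ` if some subsequence of `π`
(one-line notation) is order-isomorphic to `τ`. -/
def PattContains {k n : ℕ} (τ : Fin k → Fin k) (π : Fin n → Fin n) : Prop :=
  ∃ f : Fin k ↪o Fin n, ∀ a b : Fin k, τ a < τ b ↔ π (f a) < π (f b)

/-- The number of permutations of `{1,...,n}` avoiding the pattern `τ`. -/
noncomputable def avoiders {k : ℕ} (τ : Fin k → Fin k) (n : ℕ) : ℕ :=
  Nat.card {π : Equiv.Perm (Fin n) // ¬ PattContains τ ⇑π}

/-- The direct sum `diag(A, C)` of two permutation patterns, with `A` in the top-left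
block (the first `k` positions take the `k` largest values via `α`) and `γ` in the
bottom-right block. -/
def blockSum {k m : ℕ} (α : Fin k → Fin k) (γ : Fin m → Fin m) (i : Fin (k + m)) :
    Fin (k + m) :=
  if h : (i : ℕ) < k then (α ⟨i, h⟩).addNat m
  else Fin.castLE (Nat.le_add_left m k)
    (γ ⟨(i : ℕ) - k, by have hi := i.isLt; omega⟩)

open Polynomial

namespace BlockWilf

/-- Functions on block lists. A list `[g₁, g₂, …]` encodes the composition `(g₁ + 1, g₂ + 1, …)`. -/
abbrev Fn := List ℕ → ℕ

/-- Precomposition with the removal of one unit from the first block. -/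
def lower : Module.End ℕ Fn where
  toFun F := fun
    | [] => 0
    | 0 :: L => F L
    | (g + 1) :: L => F (g :: L)
  map_add' F G := by ext (_ | ⟨_ | g, L⟩) <;> simp
  map_smul' c F := by ext (_ | ⟨_ | g, L⟩) <;> simp

/-- Sum over all ways to add a unit to the first block and split the result in two. -/
def splitRaise : Module.End ℕ Fn where
  toFun F := fun
    | [] => F [0]
    | g :: L => ∑ y ∈ Finset.range (g + 1), F (y :: (g - y) :: L) + F ((g + 1) :: L)
  map_add' F G := by ext (_ | ⟨g, L⟩) <;> simp [Finset.sum_add_distrib]; ring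
  map_smul' c F := by ext (_ | ⟨g, L⟩) <;> simp [Finset.mul_sum, mul_add]

/-- Sum over all ways to split the first block in two. -/
def splitHead : Module.End ℕ Fn where
  toFun F := fun
    | [] => 0
    | g :: L => ∑ i ∈ Finset.range g, F (i :: (g - 1 - i) :: L)
  map_add' F G := by ext (_ | ⟨g, L⟩) <;> simp [Finset.sum_add_distrib]
  map_smul' c F := by ext (_ | ⟨g, L⟩) <;> simp [Finset.mul_sum]

/-- Sum over all ways to merge a block of excess `a` with at least one of the blocks after it. -/
def mergeSum (F : Fn) : ℕ → Fn
  | _, [] => 0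
  | a, h :: L => F ((a + h + 1) :: L) + mergeSum F (a + h + 1) L

lemma mergeSum_add (F G : Fn) (a : ℕ) (L : List ℕ) :
    mergeSum (F + G) a L = mergeSum F a L + mergeSum G a L := by
  induction L generalizing a with
  | nil => rfl
  | cons h L ih => simp only [mergeSum, ih, Pi.add_apply]; ring

lemma mergeSum_smul (c : ℕ) (F : Fn) (a : ℕ) (L : List ℕ) :
    mergeSum (c • F) a L = c * mergeSum F a L := by
  induction L generalizing a with
  | nil => rfl
  | cons h L ih => simp only [mergeSum, ih, Pi.smul_apply, smul_eq_mul]; ring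

/-- Sum over all ways to merge an initial segment of the blocks together with a new unit. -/
def mergeRaise : Module.End ℕ Fn where
  toFun F := fun
    | [] => F [0]
    | g :: L => F (0 :: g :: L) + F ((g + 1) :: L) + mergeSum F (g + 1) L
  map_add' F G := by ext (_ | ⟨g, L⟩) <;> simp [mergeSum_add]; ring
  map_smul' c F := by ext (_ | ⟨g, L⟩) <;>
    simp only [mergeSum_smul, Pi.smul_apply, smul_eq_mul, RingHom.id_apply, mul_add]

/-- Sum over all ways to merge an initial segment of at least two blocks. -/
def mergeHead : Module.End ℕ Fn where
  toFun F := fun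
    | [] => 0
    | g :: L => mergeSum F g L
  map_add' F G := by ext (_ | ⟨g, L⟩) <;> simp [mergeSum_add]
  map_smul' c F := by ext (_ | ⟨g, L⟩) <;>
    simp only [mergeSum_smul, Pi.smul_apply, smul_eq_mul, RingHom.id_apply, mul_zero]

@[simp] lemma lower_nil (F : Fn) : lower F [] = 0 := rfl
@[simp] lemma lower_zero (F : Fn) (L : List ℕ) : lower F (0 :: L) = F L := rfl
@[simp] lemma lower_succ (F : Fn) (g : ℕ) (L : List ℕ) :
    lower F ((g + 1) :: L) = F (g :: L) := rfl
@[simp] lemma splitRaise_nil (F : Fn) : splitRaise F [] = F [0] := rfl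
@[simp] lemma splitRaise_cons (F : Fn) (g : ℕ) (L : List ℕ) : splitRaise F (g :: L) =
    ∑ y ∈ Finset.range (g + 1), F (y :: (g - y) :: L) + F ((g + 1) :: L) := rfl
@[simp] lemma splitHead_nil (F : Fn) : splitHead F [] = 0 := rfl
@[simp] lemma splitHead_cons (F : Fn) (g : ℕ) (L : List ℕ) : splitHead F (g :: L) =
    ∑ i ∈ Finset.range g, F (i :: (g - 1 - i) :: L) := rfl
@[simp] lemma mergeRaise_nil (F : Fn) : mergeRaise F [] = F [0] := rfl
@[simp] lemma mergeRaise_cons (F : Fn) (g : ℕ) (L : List ℕ) : mergeRaise F (g :: L) =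
    F (0 :: g :: L) + F ((g + 1) :: L) + mergeSum F (g + 1) L := rfl
@[simp] lemma mergeHead_nil (F : Fn) : mergeHead F [] = 0 := rfl
@[simp] lemma mergeHead_cons (F : Fn) (g : ℕ) (L : List ℕ) :
    mergeHead F (g :: L) = mergeSum F g L := rfl

/-- The part of `lower` supported on lists whose first block has at least two units. -/
def lowerLong : Module.End ℕ Fn where
  toFun F := fun
    | (g + 1) :: L => F (g :: L)
    | _ => 0
  map_add' F G := by ext (_ | ⟨_ | g, L⟩) <;> simp
  map_smul' c F := by ext (_ | ⟨_ | g, L⟩) <;> simp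

/-- The part of `lower` supported on lists with a first block of one unit and a second block. -/
def lowerShort : Module.End ℕ Fn where
  toFun F := fun
    | 0 :: h :: L => F (h :: L)
    | _ => 0
  map_add' F G := by ext (_ | ⟨_ | g, _ | ⟨h, L⟩⟩) <;> simp
  map_smul' c F := by ext (_ | ⟨_ | g, _ | ⟨h, L⟩⟩) <;> simp

@[simp] lemma lowerLong_nil (F : Fn) : lowerLong F [] = 0 := rfl
@[simp] lemma lowerLong_zero (F : Fn) (L : List ℕ) : lowerLong F (0 :: L) = 0 := rfl
@[simp] lemma lowerLong_succ (F : Fn) (g : ℕ) (L : List ℕ) :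
    lowerLong F ((g + 1) :: L) = F (g :: L) := rfl
@[simp] lemma lowerShort_nil (F : Fn) : lowerShort F [] = 0 := rfl
@[simp] lemma lowerShort_zero_nil (F : Fn) : lowerShort F [0] = 0 := rfl
@[simp] lemma lowerShort_zero_cons (F : Fn) (h : ℕ) (L : List ℕ) :
    lowerShort F (0 :: h :: L) = F (h :: L) := rfl
@[simp] lemma lowerShort_succ (F : Fn) (g : ℕ) (L : List ℕ) :
    lowerShort F ((g + 1) :: L) = 0 := rfl

lemma splitHead_mul_lower : splitHead * lower = lowerLong * (1 + splitHead) := by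
  ext F (_ | ⟨_ | g, L⟩)
  · simp
  · simp
  · simp [Finset.sum_range_succ']
    rw [add_comm]
    congr 1
    exact Finset.sum_congr rfl fun i _ => by congr 3; omega

lemma splitHead_mul_lowerLong : splitHead * lowerLong = lowerLong * splitHead := by
  ext F (_ | ⟨_ | g, L⟩)
  · simp
  · simp
  · simp [Finset.sum_range_succ']
    exact Finset.sum_congr rfl fun i _ => by congr 3; omega

lemma splitRaise_lower_cons (F : Fn) (g : ℕ) (L : List ℕ) :
    splitRaise (lower F) (g :: L) = (splitHead F + 2 • F) (g :: L) := by
  simp [Finset.sum_range_succ']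
  rw [add_assoc, ← two_mul]
  congr 1
  exact Finset.sum_congr rfl fun i _ => by congr 3; omega

lemma splitRaise_lowerLong_cons (F : Fn) (g : ℕ) (L : List ℕ) :
    splitRaise (lowerLong F) (g :: L) = (F + splitHead F) (g :: L) := by
  simp [Finset.sum_range_succ']
  rw [add_comm]
  congr 1
  exact Finset.sum_congr rfl fun i _ => by congr 3; omega

lemma mergeSum_lower_succ (F : Fn) (a : ℕ) (L : List ℕ) :
    mergeSum (lower F) (a + 1) L = mergeSum F a L := by
  induction L generalizing a with
  | nil => rfl
  | cons h L ih =>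
    rw [mergeSum, mergeSum, show a + 1 + h + 1 = (a + h + 1) + 1 by ring, lower_succ, ih]

lemma mergeSum_lowerShort (F : Fn) (a : ℕ) (L : List ℕ) : mergeSum (lowerShort F) a L = 0 := by
  induction L generalizing a with
  | nil => rfl
  | cons h L ih => rw [mergeSum, lowerShort_succ, ih]

lemma mergeHead_mul_lower : mergeHead * lower = lower * mergeHead + lowerShort := by
  ext F (_ | ⟨_ | g, _ | ⟨h, L⟩⟩)
  · simp
  · simp [mergeSum]
  · simp [mergeSum, mergeSum_lower_succ, add_comm]
  · simp [mergeSum]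
  · simp [mergeSum_lower_succ]

lemma mergeHead_mul_lowerShort : mergeHead * lowerShort = 0 := by
  ext F (_ | ⟨g, L⟩) <;> simp [mergeSum_lowerShort]

lemma mergeRaise_lower_cons (F : Fn) (g : ℕ) (L : List ℕ) :
    mergeRaise (lower F) (g :: L) = (mergeHead F + 2 • F) (g :: L) := by
  simp [mergeSum_lower_succ]; ring

lemma mergeRaise_lowerShort_cons (F : Fn) (g : ℕ) (L : List ℕ) :
    mergeRaise (lowerShort F) (g :: L) = F (g :: L) := by
  simp [mergeSum_lowerShort]

/-- The polynomial to which raising, applying `p`, and lowering amounts on nonempty lists. -/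
noncomputable def excursion (p : ℕ[X]) : ℕ[X] := X * p + 2 • p + p.divX

lemma divX_X_mul (p : ℕ[X]) : (X * p).divX = p := by
  ext n
  rw [coeff_divX, mul_comm, coeff_mul_X]

lemma divX_nsmul (a : ℕ) (p : ℕ[X]) : (a • p).divX = a • p.divX := by
  rw [smul_eq_C_mul, smul_eq_C_mul, divX_C_mul]

lemma aeval_splitHead_mul_lower (p : ℕ[X]) : aeval splitHead p * lower =
    p.coeff 0 • lower + lowerLong * ((1 + splitHead) * aeval splitHead p.divX) := by
  induction p using Polynomial.induction_on' with
  | add p q hp hq =>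
    simp only [map_add, add_mul, mul_add, divX_add, coeff_add, add_smul] at *
    rw [hp, hq]; abel
  | monomial n a =>
    have key : ∀ n, splitHead ^ n * lowerLong = lowerLong * splitHead ^ n := fun n =>
      (Commute.pow_left (show Commute splitHead lowerLong from splitHead_mul_lowerLong) n).eq
    rw [← mul_one a, ← smul_eq_mul a, ← smul_monomial, monomial_one_right_eq_X_pow, divX_nsmul,
      map_nsmul, map_nsmul, coeff_smul, smul_mul_assoc, mul_smul_comm, mul_smul_comm,
      smul_assoc, ← smul_add]
    congr 1
    cases n with
    | zero => simp
    | succ n =>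
      rw [divX_X_pow]
      simp only [Nat.add_eq_zero_iff, one_ne_zero, and_false, if_false, map_pow, aeval_X,
        Nat.add_sub_cancel, coeff_X_pow]
      rw [if_neg (Nat.succ_ne_zero n).symm, zero_smul, zero_add, pow_succ, mul_assoc,
        splitHead_mul_lower, ← mul_assoc, key, mul_assoc, mul_add, add_mul, mul_one, one_mul, ← pow_succ, ← pow_succ']

lemma aeval_mergeHead_mul_lower (p : ℕ[X]) : aeval mergeHead p * lower =
    lower * aeval mergeHead p + lowerShort * aeval mergeHead p.divX := by
  induction p using Polynomial.induction_on' with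
  | add p q hp hq =>
    simp only [map_add, add_mul, mul_add, divX_add] at *
    rw [hp, hq]; abel
  | monomial n a =>
    have key : ∀ n, mergeHead ^ (n + 1) * lower =
        lower * mergeHead ^ (n + 1) + lowerShort * mergeHead ^ n := by
      intro n
      induction n with
      | zero => simpa using mergeHead_mul_lower
      | succ n ih =>
        rw [pow_succ', mul_assoc, ih, mul_add, ← mul_assoc, ← mul_assoc, mergeHead_mul_lowerShort,
          mergeHead_mul_lower, zero_mul, add_zero, add_mul, mul_assoc]
    rw [← mul_one a, ← smul_eq_mul a, ← smul_monomial, monomial_one_right_eq_X_pow, divX_nsmul,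
      map_nsmul, map_nsmul, smul_mul_assoc, mul_smul_comm, mul_smul_comm, ← smul_add]
    congr 1
    cases n with
    | zero => simp
    | succ n =>
      rw [divX_X_pow]
      simpa only [Nat.add_eq_zero_iff, one_ne_zero, and_false, if_false, map_pow, aeval_X,
        Nat.add_sub_cancel] using key n

lemma aeval_apply_nil {N : Module.End ℕ Fn} (hN : ∀ F, N F [] = 0) (p : ℕ[X]) (F : Fn) :
    aeval N p F [] = p.coeff 0 * F [] := by
  conv_lhs => rw [← X_mul_divX_add p, map_add, map_mul, aeval_X, aeval_C]
  rw [LinearMap.add_apply, Pi.add_apply, Module.End.mul_apply, hN, zero_add,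
    Module.algebraMap_end_apply, Pi.smul_apply, smul_eq_mul]

/-- The properties of a raising operator `U`, together with an auxiliary operator `N`, that
determine all the numbers obtained by applying `U` and `lower` in any order. -/
structure IsRaising (U N : Module.End ℕ Fn) : Prop where
  head_nil : ∀ F, N F [] = 0
  raise_nil : ∀ F p, U (aeval N p (lower F)) [] = p.coeff 0 * F []
  raise_cons : ∀ F p g L, U (aeval N p (lower F)) (g :: L) = aeval N (excursion p) F (g :: L)
  raise_single : U (Pi.single [] 1) = 0
  head_single : N (Pi.single [] 1) = 0

lemma IsRaising.aeval_single {U N : Module.End ℕ Fn} (h : IsRaising U N) (p : ℕ[X]) :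
    aeval N p (Pi.single [] 1 : Fn) = p.coeff 0 • (Pi.single [] 1 : Fn) := by
  conv_lhs => rw [← divX_mul_X_add p, map_add, map_mul, aeval_X, aeval_C]
  rw [LinearMap.add_apply, Module.End.mul_apply, h.head_single, map_zero, zero_add,
    Module.algebraMap_end_apply]

lemma mergeSum_single (a : ℕ) (L : List ℕ) : mergeSum (Pi.single [] 1) a L = 0 := by
  induction L generalizing a with
  | nil => rfl
  | cons h L ih => simp [mergeSum, ih]

lemma isRaising_split : IsRaising splitRaise splitHead where
  head_nil _ := rfl
  raise_nil F p := by
    have h := congrFun (LinearMap.congr_fun (aeval_splitHead_mul_lower p) F) [0]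
    simpa using h
  raise_cons F p g L := by
    have h := LinearMap.congr_fun (aeval_splitHead_mul_lower p) F
    rw [Module.End.mul_apply] at h
    rw [h, excursion]
    conv_rhs => rw [← X_mul_divX_add p]
    simp only [LinearMap.add_apply, map_add, LinearMap.smul_apply, Module.End.mul_apply, map_nsmul,
      Pi.add_apply, Pi.smul_apply, splitRaise_lower_cons, splitRaise_lowerLong_cons, map_mul,
      aeval_X, aeval_C, Module.algebraMap_end_apply, Module.End.one_apply, divX_add, divX_C,
      divX_X_mul]
    simp
    ring
  raise_single := by
    ext (_ | ⟨g, L⟩) <;> simp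
  head_single := by
    ext (_ | ⟨g, L⟩) <;> simp

lemma isRaising_merge : IsRaising mergeRaise mergeHead where
  head_nil _ := rfl
  raise_nil F p := by
    have h := congrFun (LinearMap.congr_fun (aeval_mergeHead_mul_lower p) F) [0]
    simpa [aeval_apply_nil (N := mergeHead) fun _ => rfl] using h
  raise_cons F p g L := by
    have h := LinearMap.congr_fun (aeval_mergeHead_mul_lower p) F
    rw [Module.End.mul_apply] at h
    rw [h, excursion]
    simp only [LinearMap.add_apply, map_add, LinearMap.smul_apply, Module.End.mul_apply, map_nsmul,
      Pi.add_apply, Pi.smul_apply, mergeRaise_lower_cons, mergeRaise_lowerShort_cons, map_mul,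
      aeval_X]
  raise_single := by
    ext (_ | ⟨g, L⟩) <;> simp [mergeSum_single]
  head_single := by
    ext (_ | ⟨g, L⟩) <;> simp [mergeSum_single]

/-- Apply a word in `U` (for `true`) and `lower` (for `false`) to the indicator of `[]`. -/
def evalWord (U : Module.End ℕ Fn) : List Bool → Fn
  | [] => Pi.single [] 1
  | true :: w => U (evalWord U w)
  | false :: w => lower (evalWord U w)

/-- The stack of polynomials describing a word, one for each level below the current one. -/
noncomputable def polyStack : List Bool → List ℕ[X]
  | [] => [1]
  | false :: w => match polyStack w with
    | [] => []
    | p :: s => 1 :: p :: s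
  | true :: w => match polyStack w with
    | [] => []
    | [_] => []
    | [p, q] => [C (p.coeff 0) * q]
    | p :: q :: r :: s => excursion p * q :: r :: s

/-- The function described by a stack of polynomials. -/
noncomputable def evalStack (N : Module.End ℕ Fn) : List ℕ[X] → Fn
  | [] => 0
  | [p] => p.coeff 0 • Pi.single [] 1
  | p :: q :: s => aeval N p (lower (evalStack N (q :: s)))

lemma evalStack_cons_cons_nil {U N : Module.End ℕ Fn} (h : IsRaising U N) (p q : ℕ[X])
    (s : List ℕ[X]) : evalStack N (p :: q :: s) [] = 0 := by
  rw [evalStack, aeval_apply_nil h.head_nil, lower_nil, mul_zero]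

lemma evalWord_eq_evalStack {U N : Module.End ℕ Fn} (h : IsRaising U N) (w : List Bool) :
    evalWord U w = evalStack N (polyStack w) := by
  induction w with
  | nil => simp [evalWord, polyStack, evalStack]
  | cons b w ih =>
    cases b with
    | false =>
      rw [evalWord, ih, polyStack]
      rcases polyStack w with _ | ⟨p, s⟩
      · simp [evalStack]
      · simp [evalStack]
    | true =>
      rw [evalWord, ih, polyStack]
      rcases polyStack w with _ | ⟨p, _ | ⟨q, _ | ⟨r, s⟩⟩⟩
      · simp [evalStack]
      · simp only [evalStack, map_nsmul, h.raise_single, smul_zero]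
      · ext (_ | ⟨g, L⟩)
        · simp only [evalStack, h.raise_nil]
          simp
        · simp only [evalStack, h.raise_cons]
          simp only [map_nsmul, Pi.smul_apply, h.aeval_single]
          simp
      · ext (_ | ⟨g, L⟩)
        · rw [evalStack, h.raise_nil, evalStack_cons_cons_nil h, mul_zero,
            evalStack_cons_cons_nil h]
        · rw [evalStack, h.raise_cons]
          simp only [evalStack, map_mul, Module.End.mul_apply]

lemma evalWord_nil_eq {U N U' N' : Module.End ℕ Fn} (h : IsRaising U N) (h' : IsRaising U' N')
    (w : List Bool) : evalWord U w [] = evalWord U' w [] := by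
  rw [evalWord_eq_evalStack h, evalWord_eq_evalStack h']
  rcases polyStack w with _ | ⟨p, _ | ⟨q, s⟩⟩
  · rfl
  · rfl
  · rw [evalStack_cons_cons_nil h, evalStack_cons_cons_nil h']

/-- Add one unit to the first block. -/
def bump : List ℕ → List ℕ
  | [] => []
  | g :: L => (g + 1) :: L

@[simp] lemma bump_cons (g : ℕ) (L : List ℕ) : bump (g :: L) = (g + 1) :: L := rfl

lemma lower_bump {F : Fn} {K : List ℕ} (hK : K ≠ []) : lower F (bump K) = F K := by
  cases K with
  | nil => exact absurd rfl hK
  | cons => rfl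

lemma mergeSum_bump (F : Fn) (a : ℕ) (L : List ℕ) :
    mergeSum (fun K => F (bump K)) a L = mergeSum F (a + 1) L := by
  induction L generalizing a with
  | nil => rfl
  | cons h L ih =>
    rw [mergeSum, mergeSum, ih, bump_cons, show a + 1 + h + 1 = a + h + 1 + 1 by ring]

/-- The lengths of the maximal increasing runs, each reduced by one. -/
def runs : List ℕ → List ℕ
  | [] => []
  | [_] => [0]
  | a :: c :: s => if a < c then bump (runs (c :: s)) else 0 :: runs (c :: s)

/-- The sizes of the blocks in which each entry but the last has a larger entry to its right,
each reduced by one. -/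
def comps : List ℕ → List ℕ
  | [] => []
  | a :: s => if ∃ c ∈ s, a < c then bump (comps s) else 0 :: comps s

lemma bump_ne_nil {K : List ℕ} (hK : K ≠ []) : bump K ≠ [] := by
  cases K with
  | nil => exact absurd rfl hK
  | cons => simp

lemma runs_cons_ne_nil (a : ℕ) (s : List ℕ) : runs (a :: s) ≠ [] := by
  induction s generalizing a with
  | nil => simp [runs]
  | cons c s ih =>
    rw [runs]
    split_ifs
    · exact bump_ne_nil (ih c)
    · simp

lemma comps_cons_ne_nil (a : ℕ) (s : List ℕ) : comps (a :: s) ≠ [] := by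
  induction s generalizing a with
  | nil => simp [comps]
  | cons c s ih =>
    rw [comps]
    split_ifs
    · exact bump_ne_nil (ih c)
    · simp

/-- `c` plays the role of the largest entry in an occurrence of `213`. -/
def Bad213 (c : ℕ) (l : List ℕ) : Prop := ∃ a a', a' < a ∧ a < c ∧ [a, a', c].Sublist l

/-- `c` plays the role of the largest entry in an occurrence of `132`. -/
def Bad132 (c : ℕ) (l : List ℕ) : Prop := ∃ a a', a < a' ∧ a' < c ∧ [a, c, a'].Sublist l

open Classical in
/-- The sum of `G` over the ways of inserting `M` in `s` that satisfy `¬ bad M`. -/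
noncomputable def insertSum (bad : ℕ → List ℕ → Prop) (M : ℕ) (s : List ℕ) (G : List ℕ → ℕ) : ℕ :=
  ((s.permutations'Aux M).map fun s' => if bad M s' then 0 else G s').sum

/-- The properties of the statistic `blocks` that reduce the enumeration of lists
constrained by `bad` to applications of the operators `U` and `lower`. -/
structure IsEncoding (bad : ℕ → List ℕ → Prop) (blocks : List ℕ → List ℕ)
    (U : Module.End ℕ Fn) : Prop where
  bad_filter : ∀ c l, bad c (l.filter (· ≤ c)) ↔ bad c l
  bad_mono : ∀ c l l', l.Sublist l' → bad c l → bad c l'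
  blocks_nil : blocks [] = []
  lower_blocks : ∀ F a s, lower F (blocks (a :: s)) = F (blocks s)
  insertSum_blocks : ∀ M s F, s.Nodup → (∀ x ∈ s, x < M) → (∀ c ∈ s, ¬ bad c s) →
    insertSum bad M s (fun s' => F (blocks s')) = U F (blocks s)

lemma bad213_cons {M a : ℕ} {l : List ℕ} :
    Bad213 M (a :: l) ↔ Bad213 M l ∨ a < M ∧ ∃ a' < a, [a', M].Sublist l := by
  simp only [Bad213, List.cons_sublist_cons']
  constructor
  · rintro ⟨x, y, h, h', h'' | ⟨rfl, h''⟩⟩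
    · exact Or.inl ⟨x, y, h, h', h''⟩
    · exact Or.inr ⟨h', y, h, h''⟩
  · rintro (⟨x, y, h, h', h''⟩ | ⟨h', y, h, h''⟩)
    · exact ⟨x, y, h, h', Or.inl h''⟩
    · exact ⟨a, y, h, h', Or.inr ⟨rfl, h''⟩⟩

lemma bad132_cons {M a : ℕ} {l : List ℕ} :
    Bad132 M (a :: l) ↔ Bad132 M l ∨ ∃ a', a < a' ∧ a' < M ∧ [M, a'].Sublist l := by
  simp only [Bad132, List.cons_sublist_cons']
  constructor
  · rintro ⟨x, y, h, h', h'' | ⟨rfl, h''⟩⟩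
    · exact Or.inl ⟨x, y, h, h', h''⟩
    · exact Or.inr ⟨y, h, h', h''⟩
  · rintro (⟨x, y, h, h', h''⟩ | ⟨y, h, h', h''⟩)
    · exact ⟨x, y, h, h', Or.inl h''⟩
    · exact ⟨a, y, h, h', Or.inr ⟨rfl, h''⟩⟩

lemma mem_of_mem_permutations'Aux {M : ℕ} {s s' : List ℕ} (h : s' ∈ s.permutations'Aux M) :
    s'.Perm (M :: s) := by
  induction s generalizing s' with
  | nil => simp_all [List.permutations'Aux]
  | cons a s ih =>
    simp only [List.permutations'Aux, List.mem_cons, List.mem_map] at h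
    rcases h with rfl | ⟨t, ht, rfl⟩
    · rfl
    · exact ((ih ht).cons a).trans (List.Perm.swap M a s)

lemma not_bad213_cons_self {M : ℕ} {s : List ℕ} (h : ∀ x ∈ s, x < M) : ¬ Bad213 M (M :: s) := by
  rw [bad213_cons]
  rintro (⟨a, a', -, -, h'⟩ | ⟨h', -⟩)
  · exact (h M (h'.subset (by simp))).false
  · exact h'.false

lemma not_bad132_cons_self {M : ℕ} {s : List ℕ} (h : ∀ x ∈ s, x < M) : ¬ Bad132 M (M :: s) := by
  rw [bad132_cons]
  rintro (⟨a, a', -, -, h'⟩ | ⟨a', h', h'', -⟩)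
  · exact (h M (h'.subset (by simp))).false
  · omega

lemma insertSum_congr {bad bad' : ℕ → List ℕ → Prop} {M : ℕ} {s : List ℕ} {G G' : List ℕ → ℕ}
    (h : ∀ s' ∈ s.permutations'Aux M, bad M s' ↔ bad' M s')
    (h' : ∀ s' ∈ s.permutations'Aux M, G s' = G' s') :
    insertSum bad M s G = insertSum bad' M s G' := by
  classical
  unfold insertSum
  congr 1
  refine List.map_congr_left fun s' hs => ?_
  simp only [h' s' hs]
  exact if_congr (h s' hs) rfl rfl

lemma insertSum_nil {bad : ℕ → List ℕ → Prop} {M : ℕ} {G : List ℕ → ℕ} (h : ¬ bad M [M]) :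
    insertSum bad M [] G = G [M] := by
  simp [insertSum, h, List.permutations'Aux]

lemma insertSum_cons {bad : ℕ → List ℕ → Prop} {M a : ℕ} {s : List ℕ} {G : List ℕ → ℕ}
    (h : ¬ bad M (M :: a :: s)) : insertSum bad M (a :: s) G =
      G (M :: a :: s) + insertSum (fun M s => bad M (a :: s)) M s (fun s => G (a :: s)) := by
  simp only [insertSum, h, List.permutations'Aux, List.map_cons, List.sum_cons, if_false,
    List.map_map, Function.comp_def]

lemma insertSum_cons_of_bad {bad : ℕ → List ℕ → Prop} {M a : ℕ} {s : List ℕ} {G : List ℕ → ℕ}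
    (h : bad M (M :: a :: s)) : insertSum bad M (a :: s) G =
      insertSum (fun M s => bad M (a :: s)) M s (fun s => G (a :: s)) := by
  simp only [insertSum, h, List.permutations'Aux, List.map_cons, List.sum_cons, if_true,
    List.map_map, Function.comp_def, zero_add]

lemma insertSum_eq_zero {bad : ℕ → List ℕ → Prop} {M : ℕ} {s : List ℕ} {G : List ℕ → ℕ}
    (h : ∀ s' ∈ s.permutations'Aux M, bad M s') : insertSum bad M s G = 0 := by
  unfold insertSum
  refine List.sum_eq_zero fun x hx => ?_
  obtain ⟨s', hs, rfl⟩ := List.mem_map.1 hx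
  rw [if_pos (h s' hs)]

lemma exists_cons_of_mem_permutations'Aux {M c : ℕ} {s s' : List ℕ}
    (h : s' ∈ (c :: s).permutations'Aux M) :
    s' = M :: c :: s ∨ ∃ t ∈ s.permutations'Aux M, s' = c :: t := by
  simpa [List.permutations'Aux, eq_comm] using h

lemma insertSum_runs (M : ℕ) (s : List ℕ) (F : Fn) (hs : s.Nodup) (hM : ∀ x ∈ s, x < M) :
    insertSum Bad213 M s (fun s' => F (runs s')) = splitRaise F (runs s) := by
  induction s generalizing F with
  | nil =>
    rw [insertSum_nil (not_bad213_cons_self (by simp))]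
    rfl
  | cons a s ih =>
    rw [insertSum_cons (not_bad213_cons_self hM)]
    have ha : a < M := hM a (by simp)
    rw [runs, if_neg ha.not_gt]
    have hM' : ∀ x ∈ s, x < M := fun x hx => hM x (by simp [hx])
    rcases s with _ | ⟨c, s⟩
    · rw [insertSum_nil]
      · simp [runs, ha]
      · rintro ⟨x, y, -, -, h⟩
        simpa using h.length_le
    obtain ⟨g, K, hK⟩ := List.exists_cons_of_ne_nil (runs_cons_ne_nil c s)
    have hca : a ≠ c := by grind
    rw [runs]
    rcases lt_or_gt_of_ne hca with hac | hac
    · rw [insertSum_congr (bad' := Bad213) (G' := fun s => F (bump (runs s)))]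
      · rw [ih (fun K => F (bump K)) hs.of_cons hM', if_pos hac, hK]
        simp [Finset.sum_range_succ']
        ring
      · intro s' hs'
        rw [bad213_cons]
        refine ⟨?_, Or.inl⟩
        rintro (h | ⟨-, a', h, h'⟩)
        · exact h
        rcases exists_cons_of_mem_permutations'Aux hs' with rfl | ⟨t, ht, rfl⟩
        · exfalso
          rw [List.cons_sublist_cons'] at h'
          rcases h' with h' | ⟨rfl, h'⟩
          · exact (hM' M (h'.subset (by simp))).false
          · omega
        · rw [bad213_cons]
          refine Or.inr ⟨hM' c (by simp), a', by omega, ?_⟩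
          rw [List.cons_sublist_cons'] at h'
          rcases h' with h' | ⟨rfl, h'⟩
          · exact h'
          · omega
      · intro s' hs'
        rcases exists_cons_of_mem_permutations'Aux hs' with rfl | ⟨t, ht, rfl⟩
        · rw [runs, if_pos ha]
        · rw [runs, if_pos hac]
    · rw [insertSum_cons, insertSum_eq_zero]
      · simp [runs, ha, (hM' c (by simp)).not_gt, hac.not_gt]
      · intro s' hs'
        rw [bad213_cons]
        refine Or.inr ⟨ha, c, hac, List.cons_sublist_cons.2 (List.singleton_sublist.2 ?_)⟩
        exact (mem_of_mem_permutations'Aux hs').mem_iff.2 (by simp)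
      · rw [bad213_cons]
        rintro (h | ⟨-, a', h, h'⟩)
        · exact not_bad213_cons_self hM' h
        · rw [List.cons_sublist_cons'] at h'
          rcases h' with h' | ⟨rfl, h'⟩
          · exact (hM' M (h'.subset (by simp))).false
          · omega

lemma insertSum_comps (M : ℕ) (s : List ℕ) (F : Fn) (hs : s.Nodup) (hM : ∀ x ∈ s, x < M)
    (hb : ∀ c ∈ s, ¬ Bad132 c s) :
    insertSum Bad132 M s (fun s' => F (comps s')) = mergeRaise F (comps s) := by
  induction s generalizing F with
  | nil =>
    rw [insertSum_nil (not_bad132_cons_self (by simp))]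
    simp [comps]
  | cons a s ih =>
    rw [insertSum_cons (not_bad132_cons_self hM)]
    have ha : a < M := hM a (by simp)
    have hM' : ∀ x ∈ s, x < M := fun x hx => hM x (by simp [hx])
    have hb' : ∀ c ∈ s, ¬ Bad132 c s := fun c hc h =>
      hb c (by simp [hc]) (bad132_cons.2 (Or.inl h))
    have h0 : ∀ s' ∈ s.permutations'Aux M, comps (a :: s') = bump (comps s') := fun s' hs' => by
      rw [comps, if_pos]
      exact ⟨M, (mem_of_mem_permutations'Aux hs').mem_iff.2 (by simp), ha⟩
    have hMs : comps (M :: a :: s) = 0 :: comps (a :: s) := by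
      rw [comps, if_neg]
      rintro ⟨c, hc, h⟩
      exact (hM c hc).not_gt h
    have ih' := ih (fun K => F (bump K)) hs.of_cons hM' hb'
    rw [hMs]
    by_cases hmax : ∃ c ∈ s, a < c
    · rcases s with _ | ⟨c, s⟩
      · simp at hmax
      obtain ⟨g, K, hK⟩ := List.exists_cons_of_ne_nil (comps_cons_ne_nil c s)
      have h1 : comps (M :: c :: s) = 0 :: comps (c :: s) := by
        rw [comps, if_neg]
        rintro ⟨c, hc, h⟩
        exact (hM' c hc).not_gt h
      have hca : a ≠ c := by grind
      rw [insertSum_cons_of_bad, comps, if_pos hmax, hK]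
      · rw [insertSum_cons (not_bad132_cons_self hM'), h1, hK] at ih'
        have h2 : insertSum (fun M s => Bad132 M (a :: c :: s)) M s
              (fun s => F (comps (a :: c :: s))) =
            insertSum (fun M s => Bad132 M (c :: s)) M s
              (fun s => F (bump (comps (c :: s)))) := by
          refine insertSum_congr (fun s' hs' => ?_) (fun s' hs' => ?_)
          · rw [bad132_cons]
            refine ⟨?_, Or.inl⟩
            rintro (h | ⟨a', h, h', h''⟩)
            · exact h
            rw [List.cons_sublist_cons'] at h''
            rcases h'' with h'' | ⟨rfl, -⟩
            · rw [bad132_cons]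
              refine Or.inr ⟨a', ?_, h', h''⟩
              have ha' : a' ∈ s := by
                have := (mem_of_mem_permutations'Aux hs').mem_iff.1 (h''.subset (by simp : a' ∈ _))
                simp only [List.mem_cons] at this
                exact this.resolve_left h'.ne
              by_contra hlt
              have hne : c ≠ a' := by grind
              refine hb c (by simp) ⟨a, a', h, by omega, ?_⟩
              exact List.cons_sublist_cons.2 (List.cons_sublist_cons.2
                (List.singleton_sublist.2 ha'))
            · exact ((hM' M (by simp)).false).elim
          · rw [h0]
            simp [List.permutations'Aux, hs']
        rw [h2]
        simp only [bump_cons, mergeRaise_cons, mergeSum_bump] at ih' ⊢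
        omega
      · obtain ⟨e, he, hae⟩ := hmax
        exact bad132_cons.2 (Or.inr ⟨e, hae, hM' e he, List.cons_sublist_cons.2
          (List.singleton_sublist.2 he)⟩)
    · rw [comps, if_neg hmax, insertSum_congr (bad' := Bad132) (G' := fun s => F (bump (comps s))),
        ih']
      · rcases comps s with _ | ⟨k, K⟩
        · simp [mergeSum]
        · simp [mergeSum, mergeSum_bump]
          ring_nf
      · intro s' hs'
        rw [bad132_cons]
        refine ⟨?_, Or.inl⟩
        rintro (h | ⟨a', h, h', h''⟩)
        · exact h
        have := (mem_of_mem_permutations'Aux hs').mem_iff.1 (h''.subset (by simp : a' ∈ _))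
        simp only [List.mem_cons] at this
        exact absurd ⟨a', this.resolve_left h'.ne, h⟩ hmax
      · intro s' hs'
        rw [h0 s' hs']

lemma sublist_filter_le_iff {c : ℕ} {l l' : List ℕ} (h : ∀ x ∈ l, x ≤ c) :
    l.Sublist (l'.filter (· ≤ c)) ↔ l.Sublist l' := by
  refine ⟨fun h' => h'.trans List.filter_sublist, fun h' => ?_⟩
  have := h'.filter (· ≤ c)
  rwa [List.filter_eq_self.2 (by simpa using h)] at this

lemma isEncoding_runs : IsEncoding Bad213 runs splitRaise where
  bad_filter c l := by
    refine exists_congr fun a => exists_congr fun a' => and_congr_right fun h =>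
      and_congr_right fun h' => sublist_filter_le_iff ?_
    simp; omega
  bad_mono c l l' hl := fun ⟨a, a', h, h', h''⟩ => ⟨a, a', h, h', h''.trans hl⟩
  blocks_nil := rfl
  lower_blocks F a s := by
    rcases s with _ | ⟨c, s⟩
    · rfl
    · rw [runs]
      split_ifs
      · exact lower_bump (runs_cons_ne_nil c s)
      · rfl
  insertSum_blocks M s F hs hM _ := insertSum_runs M s F hs hM

lemma isEncoding_comps : IsEncoding Bad132 comps mergeRaise where
  bad_filter c l := by
    refine exists_congr fun a => exists_congr fun a' => and_congr_right fun h =>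
      and_congr_right fun h' => sublist_filter_le_iff ?_
    simp; omega
  bad_mono c l l' hl := fun ⟨a, a', h, h', h''⟩ => ⟨a, a', h, h', h''.trans hl⟩
  blocks_nil := rfl
  lower_blocks F a s := by
    rw [comps]
    split_ifs with h
    · obtain ⟨c, hc, -⟩ := h
      rcases s with _ | ⟨d, s⟩
      · simp at hc
      · exact lower_bump (comps_cons_ne_nil d s)
    · rfl
  insertSum_blocks M s F hs hM hb := insertSum_comps M s F hs hM hb

/-- Every entry `c` of `q` survives the removal of the first `b c` entries, and is not bad in the
remaining list. -/
def Good (bad : ℕ → List ℕ → Prop) (b : ℕ → ℕ) (q : List ℕ) : Prop :=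
  ∀ c ∈ q, c ∈ q.drop (b c) ∧ ¬ bad c (q.drop (b c))

/-- A decreasing list such that `b` is monotone and sufficiently small on it. -/
def Admissible (b : ℕ → ℕ) : List ℕ → Prop
  | [] => True
  | M :: C => (∀ c ∈ C, c < M ∧ b c ≤ b M) ∧ b M ≤ C.length ∧ Admissible b C

open Classical in
/-- The sum of `F` over the blocks of the suffixes of good permutations of `C`. -/
noncomputable def goodSum (bad : ℕ → List ℕ → Prop) (blocks : List ℕ → List ℕ) (b : ℕ → ℕ)
    (C : List ℕ) (t : ℕ) (F : Fn) : ℕ :=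
  (C.permutations'.map fun q => if Good bad b q then F (blocks (q.drop t)) else 0).sum

lemma goodSum_succ {bad : ℕ → List ℕ → Prop} {blocks : List ℕ → List ℕ} {U : Module.End ℕ Fn}
    (h : IsEncoding bad blocks U) (b : ℕ → ℕ) {C : List ℕ} {t : ℕ} (ht : t < C.length) (F : Fn) :
    goodSum bad blocks b C (t + 1) F = goodSum bad blocks b C t (lower F) := by
  unfold goodSum
  congr 1
  refine List.map_congr_left fun q hq => ?_
  have hq' : t < q.length := by rwa [(List.mem_permutations'.1 hq).length_eq]
  rw [List.drop_eq_getElem_cons hq', h.lower_blocks]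

lemma sum_map_permutations'Aux_drop {M : ℕ} {H : List ℕ → ℕ} {t : ℕ} {q : List ℕ} (hM : M ∉ q)
    (ht : t ≤ q.length) (hH : ∀ q', M ∉ q'.drop t → H q' = 0) :
    ((q.permutations'Aux M).map H).sum =
      (((q.drop t).permutations'Aux M).map fun s => H (q.take t ++ s)).sum := by
  induction q generalizing t H with
  | nil => simp_all
  | cons a q ih =>
    cases t with
    | zero => simp
    | succ t =>
      rw [List.permutations'Aux, List.map_cons, List.sum_cons, hH, zero_add, List.map_map,
        Function.comp_def, ih (t := t) (H := fun s => H (a :: s)) (by simp_all) (by simpa using ht)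
        (fun q' h => hH _ (by simpa using h))]
      · simp
      · rw [List.drop_succ_cons]
        exact fun h => hM (List.mem_of_mem_drop h)

lemma filter_le_of_mem_permutations'Aux {M c : ℕ} (hc : c < M) {s s' : List ℕ}
    (h : s' ∈ s.permutations'Aux M) : s'.filter (· ≤ c) = s.filter (· ≤ c) := by
  induction s generalizing s' with
  | nil => simp_all [List.permutations'Aux]
  | cons a s ih =>
    rcases exists_cons_of_mem_permutations'Aux h with rfl | ⟨t, ht, rfl⟩
    · rw [List.filter_cons_of_neg (by simpa using hc)]
    · simp only [List.filter_cons, ih ht]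

lemma good_append_iff {bad : ℕ → List ℕ → Prop} {blocks : List ℕ → List ℕ} {U : Module.End ℕ Fn}
    (h : IsEncoding bad blocks U) {b : ℕ → ℕ} {q s : List ℕ} {M : ℕ}
    (hM : ∀ c ∈ q, c < M ∧ b c ≤ b M) (hq : b M ≤ q.length)
    (hs : s ∈ (q.drop (b M)).permutations'Aux M) :
    Good bad b (q.take (b M) ++ s) ↔ Good bad b q ∧ ¬ bad M s := by
  have hp := mem_of_mem_permutations'Aux hs
  have hmem : ∀ c, c ∈ q.take (b M) ++ s ↔ c = M ∨ c ∈ q := by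
    intro c
    conv_rhs => rw [← List.take_append_drop (b M) q]
    simp only [List.mem_append, hp.mem_iff, List.mem_cons]
    tauto
  have hlen : (q.take (b M)).length = b M := by simpa using hq
  have hdM : (q.take (b M) ++ s).drop (b M) = s := List.drop_left' hlen
  have hd : ∀ c ∈ q, ((q.take (b M) ++ s).drop (b c)).filter (· ≤ c) =
      (q.drop (b c)).filter (· ≤ c) := by
    intro c hc
    conv_rhs => rw [← List.take_append_drop (b M) q]
    rw [List.drop_append_of_le_length (by rw [hlen]; exact (hM c hc).2),
      List.drop_append_of_le_length (by rw [hlen]; exact (hM c hc).2), List.filter_append,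
      List.filter_append, filter_le_of_mem_permutations'Aux (hM c hc).1 hs]
  have hgood : ∀ c ∈ q, (c ∈ (q.take (b M) ++ s).drop (b c) ∧
      ¬ bad c ((q.take (b M) ++ s).drop (b c))) ↔ (c ∈ q.drop (b c) ∧ ¬ bad c (q.drop (b c))) := by
    intro c hc
    have hmem' : ∀ l : List ℕ, c ∈ l ↔ c ∈ l.filter (· ≤ c) := by simp
    rw [hmem', hmem' (q.drop _), ← h.bad_filter c, ← h.bad_filter c (q.drop _), hd c hc]
  have hMs : M ∈ s := hp.mem_iff.2 (by simp)
  constructor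
  · intro hg
    refine ⟨fun c hc => (hgood c hc).1 (hg c ((hmem c).2 (Or.inr hc))), ?_⟩
    have := (hg M ((hmem M).2 (Or.inl rfl))).2
    rwa [hdM] at this
  · rintro ⟨hg, hb⟩ c hc
    rcases (hmem c).1 hc with rfl | hc
    · rw [hdM]
      exact ⟨hMs, hb⟩
    · exact (hgood c hc).2 (hg c hc)

lemma goodSum_cons {bad : ℕ → List ℕ → Prop} {blocks : List ℕ → List ℕ} {U : Module.End ℕ Fn}
    (h : IsEncoding bad blocks U) {b : ℕ → ℕ} {M : ℕ} {C : List ℕ}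
    (hM : ∀ c ∈ C, c < M ∧ b c ≤ b M) (hC : b M ≤ C.length) (hnd : C.Nodup) (F : Fn) :
    goodSum bad blocks b (M :: C) (b M) F = goodSum bad blocks b C (b M) (U F) := by
  classical
  unfold goodSum
  rw [List.permutations', List.map_flatMap, List.flatMap, List.sum_flatten, List.map_map]
  congr 1
  refine List.map_congr_left fun q hq => ?_
  have hq := List.mem_permutations'.1 hq
  have hM' : ∀ c ∈ q, c < M ∧ b c ≤ b M := fun c hc => hM c (hq.mem_iff.1 hc)
  have hlen : b M ≤ q.length := by rwa [hq.length_eq]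
  rw [Function.comp_apply, List.map_congr_left (g := fun q' => if M ∈ q'.drop (b M) then
    (if Good bad b q' then F (blocks (q'.drop (b M))) else 0) else 0)]
  · rw [sum_map_permutations'Aux_drop (t := b M) (fun h => (hM' M h).1.false) hlen
      (fun q' h => if_neg h)]
    split_ifs with hg
    · rw [← h.insertSum_blocks M _ F ((hq.nodup_iff.2 hnd).sublist (List.drop_sublist _ _))
        (fun c hc => (hM' c (List.mem_of_mem_drop hc)).1)]
      · unfold insertSum
        congr 1
        refine List.map_congr_left fun s hs => ?_
        have hMs : M ∈ s := (mem_of_mem_permutations'Aux hs).mem_iff.2 (by simp)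
        rw [List.drop_left' (by simpa using hlen), if_pos hMs, good_append_iff h hM' hlen hs]
        simp [hg]
      · intro c hc hbad
        have hcq := List.mem_of_mem_drop hc
        refine (hg c hcq).2 (h.bad_mono _ _ _ ?_ hbad)
        exact List.drop_sublist_drop_left _ (hM' c hcq).2
    · refine List.sum_eq_zero fun x hx => ?_
      obtain ⟨s, hs, rfl⟩ := List.mem_map.1 hx
      rw [good_append_iff h hM' hlen hs]
      simp [hg]
  · intro q' hq'
    split_ifs with hg hd hd
    · rfl
    · exact absurd (hg M ((mem_of_mem_permutations'Aux hq').mem_iff.2 (by simp))).1 hd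
    · rfl
    · rfl

lemma Admissible.nodup {b : ℕ → ℕ} {C : List ℕ} (h : Admissible b C) : C.Nodup := by
  induction C with
  | nil => simp
  | cons M C ih => exact List.nodup_cons.2 ⟨fun hM => (h.1 M hM).1.false, ih h.2.2⟩

lemma goodSum_evalWord {b : ℕ → ℕ} {C : List ℕ} (hC : Admissible b C) (w : List Bool) (t : ℕ)
    (ht : ∀ c ∈ C, b c ≤ t) (ht' : t ≤ C.length) :
    goodSum Bad213 runs b C t (evalWord splitRaise w) =
      goodSum Bad132 comps b C t (evalWord mergeRaise w) := by
  induction C generalizing w t with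
  | nil => simp [goodSum, Good, runs, comps, evalWord_nil_eq isRaising_split isRaising_merge]
  | cons M C ih =>
    obtain ⟨d, rfl⟩ := Nat.exists_eq_add_of_le (ht M (by simp))
    induction d generalizing w with
    | zero =>
      rw [add_zero, goodSum_cons isEncoding_runs hC.1 hC.2.1 hC.2.2.nodup,
        goodSum_cons isEncoding_comps hC.1 hC.2.1 hC.2.2.nodup]
      exact ih hC.2.2 (true :: w) _ (fun c hc => (hC.1 c hc).2) hC.2.1
    | succ d ihd =>
      rw [← add_assoc] at ht' ⊢
      rw [goodSum_succ isEncoding_runs b ht', goodSum_succ isEncoding_comps b ht']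
      refine ihd (false :: w) (fun c hc => ?_) (by omega)
      rcases List.mem_cons.1 hc with rfl | hc
      · omega
      · exact (hC.1 c hc).2.trans (by omega)

lemma goodSum_length {bad : ℕ → List ℕ → Prop} {blocks : List ℕ → List ℕ} (h : blocks [] = [])
    (b : ℕ → ℕ) {C : List ℕ} (hC : C.Nodup) :
    goodSum bad blocks b C C.length (Pi.single [] 1) =
      Nat.card {q : List ℕ // q.Perm C ∧ Good bad b q} := by
  classical
  have hnd : C.permutations'.Nodup :=
    (List.permutations_perm_permutations' C).nodup_iff.1 (List.nodup_permutations C hC)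
  rw [Nat.subtype_card (C.permutations'.toFinset.filter (Good bad b)) (by simp),
    Finset.card_filter, List.sum_toFinset _ hnd]
  unfold goodSum
  congr 1
  refine List.map_congr_left fun q hq => ?_
  rw [List.drop_of_length_le (List.mem_permutations'.1 hq).length_eq.le, h]
  simp

/-- Good permutations for the two patterns are equinumerous. -/
lemma card_good_eq {b : ℕ → ℕ} {C : List ℕ} (hC : Admissible b C) (hb : ∀ c ∈ C, b c ≤ C.length) :
    Nat.card {q : List ℕ // q.Perm C ∧ Good Bad213 b q} =
      Nat.card {q : List ℕ // q.Perm C ∧ Good Bad132 b q} := by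
  rw [← goodSum_length isEncoding_runs.blocks_nil b hC.nodup,
    ← goodSum_length isEncoding_comps.blocks_nil b hC.nodup]
  exact goodSum_evalWord hC [] C.length hb le_rfl

/-- There is an occurrence of `τ` in `π` to the right of position `i` and below the value `v`. -/
def Covers {m N : ℕ} (τ : Fin m → Fin m) (π : Fin N → Fin N) (i : ℕ) (v : Fin N) : Prop :=
  ∃ f : Fin m ↪o Fin N, (∀ a b, τ a < τ b ↔ π (f a) < π (f b)) ∧ ∀ a, i < f a ∧ π (f a) < v

lemma Covers.mono {m N : ℕ} {τ : Fin m → Fin m} {π : Fin N → Fin N} {i j : ℕ} {v w : Fin N}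
    (h : Covers τ π i v) (hij : j ≤ i) (hvw : v ≤ w) : Covers τ π j w := by
  obtain ⟨f, hf, hf'⟩ := h
  exact ⟨f, hf, fun a => ⟨hij.trans_lt (hf' a).1, (hf' a).2.trans_le hvw⟩⟩

/-- The entry of `π` at position `i` has an occurrence of `τ` to its right and below it. -/
def Inner {m N : ℕ} (τ : Fin m → Fin m) (π : Fin N → Fin N) (i : Fin N) : Prop :=
  Covers τ π i (π i)

lemma Covers.exists_not_inner {m N : ℕ} {τ : Fin m → Fin m} {π : Fin N → Fin N} {i : ℕ}
    {v : Fin N} (h : Covers τ π i v) : ∃ f : Fin m ↪o Fin N,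
      (∀ a b, τ a < τ b ↔ π (f a) < π (f b)) ∧ (∀ a, i < f a ∧ π (f a) < v) ∧
        ∀ a, ¬ Inner τ π (f a) := by
  induction v using WellFoundedLT.induction generalizing i with
  | ind v ih =>
    obtain ⟨f, hf, hf'⟩ := h
    by_cases hin : ∃ a, Inner τ π (f a)
    · obtain ⟨a, ha⟩ := hin
      obtain ⟨f', h1, h2, h3⟩ := ih _ (hf' a).2 ha
      exact ⟨f', h1, fun b => ⟨(hf' a).1.trans (h2 b).1, (h2 b).2.trans (hf' a).2⟩, h3⟩
    · exact ⟨f, hf, hf', fun a ha => hin ⟨a, ha⟩⟩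

lemma Covers.congr {m N : ℕ} {τ : Fin m → Fin m} {π π' : Fin N → Fin N} {i : ℕ} {v : Fin N}
    (h : Covers τ π i v) (hπ : ∀ i, ¬ Inner τ π i → π' i = π i) : Covers τ π' i v := by
  obtain ⟨f, h1, h2, h3⟩ := h.exists_not_inner
  refine ⟨f, fun a b => ?_, fun a => ?_⟩
  · rw [hπ _ (h3 a), hπ _ (h3 b)]
    exact h1 a b
  · rw [hπ _ (h3 a)]
    exact h2 a

open Classical in
/-- The positions and values of the entries that are not inner. -/
noncomputable def outline {m N : ℕ} (τ : Fin m → Fin m) (π : Fin N → Fin N) (i : Fin N) :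
    Option (Fin N) :=
  if Inner τ π i then none else some (π i)

lemma outline_eq_iff {m N : ℕ} {τ : Fin m → Fin m} {π π' : Fin N → Fin N} :
    outline τ π' = outline τ π ↔
      (∀ i, ¬ Inner τ π i → π' i = π i) ∧ ∀ i, Inner τ π i → Covers τ π i (π' i) := by
  constructor
  · intro h
    have h1 : ∀ i, (Inner τ π' i ↔ Inner τ π i) ∧ (¬ Inner τ π i → π' i = π i) := by
      intro i
      have := congrFun h i
      simp only [outline] at this
      split_ifs at this with h1 h2 h2 <;> simp_all
    refine ⟨fun i => (h1 i).2, fun i hi => ?_⟩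
    have hc : Covers τ π' i (π' i) := (h1 i).1.2 hi
    exact hc.congr fun j hj => ((h1 j).2 (fun hj' => hj ((h1 j).1.2 hj'))).symm
  · rintro ⟨h1, h2⟩
    have h3 : ∀ i, Inner τ π i → Inner τ π' i := fun i hi => (h2 i hi).congr h1
    have h4 : ∀ i, ¬ Inner τ π' i → π i = π' i := fun i hi => (h1 i fun hi' => hi (h3 i hi')).symm
    ext1 i
    have h5 : Inner τ π' i → Inner τ π i := by
      intro hi
      by_contra hn
      have := Covers.congr hi h4
      rw [h1 i hn] at this
      exact hn this
    simp only [outline]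
    split_ifs with h6 h7 h7
    · rfl
    · exact absurd (h5 h6) h7
    · exact absurd (h3 i h7) h6
    · rw [h1 i h7]

lemma covers_iff_of_outline_eq {m N : ℕ} {τ : Fin m → Fin m} {π π' : Fin N → Fin N}
    (h : outline τ π' = outline τ π) (i : ℕ) (v : Fin N) : Covers τ π' i v ↔ Covers τ π i v :=
  ⟨fun hc => hc.congr fun j hj => (outline_eq_iff.1 h.symm).1 j hj,
    fun hc => hc.congr fun j hj => (outline_eq_iff.1 h).1 j hj⟩

lemma strictMono_addCases {k m N : ℕ} {g : Fin k → Fin N} {f : Fin m → Fin N} (hg : StrictMono g)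
    (hf : StrictMono f) (h : ∀ a b, g a < f b) :
    StrictMono (Fin.addCases g f : Fin (k + m) → Fin N) := by
  intro a b
  induction a using Fin.addCases with
  | left a =>
    induction b using Fin.addCases with
    | left b =>
      intro hab
      simpa using hg (show a < b from hab)
    | right b => simpa using fun _ => h a b
  | right a =>
    induction b using Fin.addCases with
    | left b =>
      intro hab
      simp only [Fin.lt_def, Fin.val_natAdd, Fin.val_castAdd] at hab
      omega
    | right b => simpa using fun hab => hf hab

lemma blockSum_castAdd {k m : ℕ} (α : Fin k → Fin k) (γ : Fin m → Fin m) (i : Fin k) :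
    (blockSum α γ (Fin.castAdd m i) : ℕ) = α i + m := by
  simp [blockSum]

lemma blockSum_natAdd {k m : ℕ} (α : Fin k → Fin k) (γ : Fin m → Fin m) (i : Fin m) :
    (blockSum α γ (Fin.natAdd k i) : ℕ) = γ i := by
  simp [blockSum]

lemma pattContains_blockSum {k m N : ℕ} {α : Fin k → Fin k} {τ : Fin m → Fin m}
    {π : Fin N → Fin N} : PattContains (blockSum α τ) π ↔
      ∃ g : Fin k ↪o Fin N, (∀ a b, α a < α b ↔ π (g a) < π (g b)) ∧
        ∃ f : Fin m ↪o Fin N, (∀ a b, τ a < τ b ↔ π (f a) < π (f b)) ∧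
          ∀ a b, g a < f b ∧ π (f b) < π (g a) := by
  have hlt : ∀ a b, blockSum α τ a < blockSum α τ b ↔
      (blockSum α τ a : ℕ) < blockSum α τ b := fun _ _ => Iff.rfl
  constructor
  · rintro ⟨F, hF⟩
    refine ⟨(Fin.castAddOrderEmb m).trans F, fun a b => ?_, (Fin.natAddOrderEmb k).trans F,
      fun a b => ?_, fun a b => ⟨?_, ?_⟩⟩
    · have := hF (Fin.castAdd m a) (Fin.castAdd m b)
      rw [hlt, blockSum_castAdd, blockSum_castAdd] at this
      simpa using this
    · have := hF (Fin.natAdd k a) (Fin.natAdd k b)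
      rw [hlt, blockSum_natAdd, blockSum_natAdd] at this
      simpa using this
    · refine F.strictMono ?_
      change (a : ℕ) < k + b
      omega
    · refine (hF (Fin.natAdd k b) (Fin.castAdd m a)).1 ?_
      rw [hlt, blockSum_natAdd, blockSum_castAdd]
      omega
  · rintro ⟨g, hg, f, hf, hgf⟩
    refine ⟨OrderEmbedding.ofStrictMono _ (strictMono_addCases g.strictMono f.strictMono
      fun a b => (hgf a b).1), fun a b => ?_⟩
    rw [hlt]
    induction a using Fin.addCases with
    | left a =>
      induction b using Fin.addCases with
      | left b => simpa [blockSum_castAdd] using hg a b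
      | right b =>
        have := (hgf a b).2
        simp [blockSum_castAdd, blockSum_natAdd, not_lt_of_gt this]
        omega
    | right a =>
      induction b using Fin.addCases with
      | left b =>
        have := (hgf b a).2
        simp [blockSum_castAdd, blockSum_natAdd, this]
        omega
      | right b => simpa [blockSum_natAdd] using hf a b

lemma strictMono_vecCons {N : ℕ} {i j k : Fin N} (hij : i < j) (hjk : j < k) :
    StrictMono ![i, j, k] := by
  rw [Fin.strictMono_iff_lt_succ]
  intro a
  fin_cases a
  · exact hij
  · exact hjk

lemma pattContains_blockSum_213 {m N : ℕ} {τ : Fin m → Fin m} {π : Fin N → Fin N} :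
    PattContains (blockSum ![1, 0, 2] τ) π ↔
      ∃ i j k, i < j ∧ j < k ∧ π j < π i ∧ π i < π k ∧ Covers τ π k (π j) := by
  rw [pattContains_blockSum]
  constructor
  · rintro ⟨g, hg, f, hf, hgf⟩
    exact ⟨g 0, g 1, g 2, g.strictMono (by decide), g.strictMono (by decide),
      (hg 1 0).1 (by decide), (hg 0 2).1 (by decide), f, hf,
      fun a => ⟨(hgf 2 a).1, (hgf 1 a).2⟩⟩
  · rintro ⟨i, j, k, hij, hjk, h1, h2, f, hf, hf'⟩
    refine ⟨OrderEmbedding.ofStrictMono _ (strictMono_vecCons hij hjk), fun a b => ?_, f, hf,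
      fun a b => ?_⟩
    · fin_cases a <;> fin_cases b <;> simp [h1, h2, h1.le, h2.le, h1.trans h2, (h1.trans h2).le]
    · have h3 : k < f b := (hf' b).1
      have h4 := (hf' b).2
      fin_cases a
      · exact ⟨(hij.trans hjk).trans h3, h4.trans h1⟩
      · exact ⟨hjk.trans h3, h4⟩
      · exact ⟨h3, h4.trans (h1.trans h2)⟩

lemma pattContains_blockSum_132 {m N : ℕ} {τ : Fin m → Fin m} {π : Fin N → Fin N} :
    PattContains (blockSum ![0, 2, 1] τ) π ↔
      ∃ i j k, i < j ∧ j < k ∧ π i < π k ∧ π k < π j ∧ Covers τ π k (π i) := by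
  rw [pattContains_blockSum]
  constructor
  · rintro ⟨g, hg, f, hf, hgf⟩
    exact ⟨g 0, g 1, g 2, g.strictMono (by decide), g.strictMono (by decide),
      (hg 0 2).1 (by decide), (hg 2 1).1 (by decide), f, hf,
      fun a => ⟨(hgf 2 a).1, (hgf 0 a).2⟩⟩
  · rintro ⟨i, j, k, hij, hjk, h1, h2, f, hf, hf'⟩
    refine ⟨OrderEmbedding.ofStrictMono _ (strictMono_vecCons hij hjk), fun a b => ?_, f, hf,
      fun a b => ?_⟩
    · fin_cases a <;> fin_cases b <;> simp [h1, h2, h1.le, h2.le, h1.trans h2, (h1.trans h2).le]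
    · have h3 : k < f b := (hf' b).1
      have h4 := (hf' b).2
      fin_cases a
      · exact ⟨(hij.trans hjk).trans h3, h4⟩
      · exact ⟨hjk.trans h3, h4.trans (h1.trans h2)⟩
      · exact ⟨h3, h4.trans h1⟩

lemma exists_perm_of_perm_map {α β : Type*} [DecidableEq α] {g : α → β} {p q : List β}
    (h : p.Perm q) {l : List α} (hl : l.Nodup) (hq : q = l.map g) :
    ∃ σ : Equiv.Perm α, (∀ x ∉ l, σ x = x) ∧ p = l.map fun x => g (σ x) := by
  induction h generalizing l with
  | nil => exact ⟨1, fun _ _ => rfl, hq⟩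
  | cons x _ ih =>
    obtain ⟨a, l, rfl, rfl, rfl⟩ := List.map_eq_cons_iff.1 hq.symm
    obtain ⟨σ, h1, rfl⟩ := ih hl.of_cons rfl
    refine ⟨σ, fun x hx => h1 x (by simp_all), ?_⟩
    rw [List.map_cons, h1 a (List.nodup_cons.1 hl).1]
  | swap x y _ =>
    obtain ⟨a, l, rfl, rfl, hl'⟩ := List.map_eq_cons_iff.1 hq.symm
    obtain ⟨b, l, rfl, rfl, rfl⟩ := List.map_eq_cons_iff.1 hl'
    refine ⟨Equiv.swap a b, fun x hx => ?_, ?_⟩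
    · simp only [List.mem_cons, not_or] at hx
      exact Equiv.swap_apply_of_ne_of_ne hx.1 hx.2.1
    · simp only [List.nodup_cons, List.mem_cons, not_or] at hl
      simp only [List.map_cons, Equiv.swap_apply_left, Equiv.swap_apply_right]
      congr 2
      refine List.map_congr_left fun x hx => ?_
      rw [Equiv.swap_apply_of_ne_of_ne] <;> rintro rfl
      · exact hl.1.2 hx
      · exact hl.2.1 hx
  | trans _ _ ih1 ih2 =>
    obtain ⟨σ, h1, h2⟩ := ih2 hl hq
    obtain ⟨ρ, h3, h4⟩ := ih1 (l := l.map σ) (hl.map σ.injective) (by rw [h2, List.map_map]; rfl)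
    refine ⟨σ.trans ρ, fun x hx => ?_, by rw [h4, List.map_map]; rfl⟩
    rw [Equiv.trans_apply, h1 x hx, h3]
    intro hx'
    obtain ⟨y, hy, hyx⟩ := List.mem_map.1 hx'
    rw [← h1 x hx] at hyx
    exact hx (σ.injective hyx ▸ hy)

lemma drop_countP_not {α : Type*} [Preorder α] {p : α → Prop} [DecidablePred p]
    (hp : ∀ x y, x ≤ y → p x → p y) {l : List α} (hl : l.Pairwise (· < ·)) :
    l.drop (l.countP fun x => ¬ p x) = l.filter p := by
  induction l with
  | nil => rfl
  | cons a l ih =>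
    rw [List.pairwise_cons] at hl
    by_cases ha : p a
    · have hall : ∀ x ∈ a :: l, p x := by
        intro x hx
        rcases List.mem_cons.1 hx with rfl | hx
        · exact ha
        · exact hp a x (hl.1 x hx).le ha
      rw [List.filter_eq_self.2 (by simpa using hall), List.countP_eq_zero.2 (by simpa using hall),
        List.drop_zero]
    · rw [List.countP_cons_of_pos (by simpa using ha), List.drop_succ_cons, ih hl.2,
        List.filter_cons_of_neg (by simpa using ha)]

lemma sublist_triple_iff {α : Type*} [LinearOrder α] {l : List α} (hl : l.Pairwise (· < ·))
    {x y z : α} : [x, y, z].Sublist l ↔ (x ∈ l ∧ y ∈ l ∧ z ∈ l) ∧ x < y ∧ y < z := by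
  constructor
  · intro h
    have h1 := h.subset
    have h2 := hl.sublist h
    simp_all
  · rintro ⟨⟨hx, hy, hz⟩, hxy, hyz⟩
    refine List.sublist_of_subperm_of_pairwise (r := (· < ·)) ?_ ?_ hl
    · refine List.subperm_of_subset ?_ ?_
      · simp [hxy.ne, hyz.ne, (hxy.trans hyz).ne]
      · simp [hx, hy, hz]
    · simp [hxy, hyz, hxy.trans hyz]

lemma admissible_of_pairwise {b : ℕ → ℕ} (hb : Monotone b) {C : List ℕ} (hC : C.Pairwise (· > ·))
    (h : ∀ M ∈ C, b M ≤ C.countP (· < M)) : Admissible b C := by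
  induction C with
  | nil => trivial
  | cons M C ih =>
    rw [List.pairwise_cons] at hC
    refine ⟨fun c hc => ⟨hC.1 c hc, hb (hC.1 c hc).le⟩, ?_, ih hC.2 fun c hc => ?_⟩
    · refine (h M (by simp)).trans ?_
      rw [List.countP_cons_of_neg (by simp)]
      exact List.countP_le_length
    · have := h c (by simp [hc])
      rwa [List.countP_cons_of_neg (by simpa using (hC.1 c hc).le)] at this

section Coding

open Classical

variable {m N : ℕ} (τ : Fin m → Fin m) (π₀ : Equiv.Perm (Fin N))

/-- The values of the inner entries, in increasing order. -/
noncomputable def innerValues : List (Fin N) :=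
  (List.finRange N).filter fun v => Inner τ π₀ (π₀.symm v)

/-- The positions of the inner entries, in decreasing order. -/
noncomputable def innerPositions : List ℕ :=
  (((List.finRange N).filter fun i => Inner τ π₀ i).map Fin.val).reverse

/-- The number of values of inner entries that cannot be placed at position `c`. -/
noncomputable def offset (c : ℕ) : ℕ :=
  (innerValues τ π₀).countP fun v => ¬ Covers τ π₀ c v

/-- The positions in `π` of the values of the inner entries of `π₀`. -/
noncomputable def code (π : Equiv.Perm (Fin N)) : List ℕ :=
  (innerValues τ π₀).map fun v => (π.symm v : ℕ)

variable {τ π₀}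

lemma mem_innerValues {v : Fin N} : v ∈ innerValues τ π₀ ↔ Inner τ π₀ (π₀.symm v) := by
  simp [innerValues]

lemma pairwise_innerValues : (innerValues τ π₀).Pairwise (· < ·) :=
  (List.pairwise_lt_finRange N).filter _

lemma apply_mem_innerValues {π : Equiv.Perm (Fin N)} (hπ : ∀ i, ¬ Inner τ π₀ i → π i = π₀ i)
    {i : Fin N} : π i ∈ innerValues τ π₀ ↔ Inner τ π₀ i := by
  rw [mem_innerValues]
  constructor
  · intro h
    by_contra hi
    rw [hπ i hi, Equiv.symm_apply_apply] at h
    exact hi h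
  · intro hi
    by_contra h
    have := hπ _ h
    rw [Equiv.apply_symm_apply] at this
    rw [π.injective this] at h
    exact h hi

lemma mem_code {π : Equiv.Perm (Fin N)} (hπ : ∀ i, ¬ Inner τ π₀ i → π i = π₀ i) {c : ℕ} :
    c ∈ code τ π₀ π ↔ ∃ i : Fin N, Inner τ π₀ i ∧ i = c := by
  simp only [code, List.mem_map]
  constructor
  · rintro ⟨v, hv, rfl⟩
    refine ⟨π.symm v, ?_, rfl⟩
    rwa [← apply_mem_innerValues hπ, Equiv.apply_symm_apply]
  · rintro ⟨i, hi, rfl⟩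
    exact ⟨π i, (apply_mem_innerValues hπ).2 hi, by simp⟩

lemma pairwise_innerPositions : (innerPositions τ π₀).Pairwise (· > ·) := by
  rw [innerPositions, List.pairwise_reverse, List.pairwise_map]
  exact (List.pairwise_lt_finRange N).filter _

lemma code_perm {π : Equiv.Perm (Fin N)} (hπ : ∀ i, ¬ Inner τ π₀ i → π i = π₀ i) :
    (code τ π₀ π).Perm (innerPositions τ π₀) := by
  refine (List.perm_ext_iff_of_nodup ?_ ?_).2 fun c => ?_
  · refine List.Nodup.map (f := fun v : Fin N => (π.symm v : ℕ)) ?_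
      (pairwise_innerValues.imp ne_of_lt)
    exact Fin.val_injective.comp π.symm.injective
  · exact pairwise_innerPositions.imp ne_of_gt
  · rw [mem_code hπ]
    simp [innerPositions]

lemma admissible_innerPositions : Admissible (offset τ π₀) (innerPositions τ π₀) := by
  refine admissible_of_pairwise (fun c d hcd => ?_) pairwise_innerPositions fun M _ => ?_
  · refine List.countP_mono_left fun v _ h => ?_
    simp only [decide_eq_true_eq] at h ⊢
    exact fun h' => h (h'.mono hcd le_rfl)
  · rw [← (code_perm (π := π₀) fun _ _ => rfl).countP_eq, code, List.countP_map]
    refine List.countP_mono_left fun v hv h => ?_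
    simp only [decide_eq_true_eq, Function.comp_apply] at h ⊢
    by_contra h'
    have hv' : Covers τ π₀ (π₀.symm v) (π₀ (π₀.symm v)) := mem_innerValues.1 hv
    exact h (hv'.mono (not_lt.1 h') (by simp))

lemma offset_le (c : ℕ) : offset τ π₀ c ≤ (innerPositions τ π₀).length := by
  rw [← (code_perm (π := π₀) fun _ _ => rfl).length_eq, code, List.length_map]
  exact List.countP_le_length

lemma drop_code (π : Equiv.Perm (Fin N)) (c : ℕ) : (code τ π₀ π).drop (offset τ π₀ c) =
    ((innerValues τ π₀).filter fun v => Covers τ π₀ c v).map fun v => (π.symm v : ℕ) := by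
  rw [code, ← List.map_drop, offset,
    drop_countP_not (fun x y hxy h => h.mono le_rfl hxy) pairwise_innerValues]

lemma good_code_iff {bad : ℕ → List ℕ → Prop} {π : Equiv.Perm (Fin N)}
    (hπ : ∀ i, ¬ Inner τ π₀ i → π i = π₀ i) : Good bad (offset τ π₀) (code τ π₀ π) ↔
      (∀ i, Inner τ π₀ i → Covers τ π₀ i (π i)) ∧
        ¬ ∃ c ∈ code τ π₀ π, bad c ((code τ π₀ π).drop (offset τ π₀ c)) := by
  have hmem : ∀ i, Inner τ π₀ i →
      ((i : ℕ) ∈ (code τ π₀ π).drop (offset τ π₀ i) ↔ Covers τ π₀ i (π i)) := by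
    intro i hi
    simp only [drop_code, List.mem_map, List.mem_filter, decide_eq_true_eq]
    constructor
    · rintro ⟨v, ⟨-, hv⟩, hvi⟩
      rwa [← Fin.ext hvi, Equiv.apply_symm_apply, Fin.ext hvi]
    · exact fun h => ⟨π i, ⟨(apply_mem_innerValues hπ).2 hi, h⟩, by simp⟩
  simp only [Good, not_exists, not_and, forall_and]
  refine and_congr_left fun _ => ⟨fun h i hi => ?_, fun h c hc => ?_⟩
  · exact (hmem i hi).1 (h i ((mem_code hπ).2 ⟨i, hi, rfl⟩))
  · obtain ⟨i, hi, rfl⟩ := (mem_code hπ).1 hc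
    exact (hmem i hi).2 (h i hi)

lemma code_injOn {π π' : Equiv.Perm (Fin N)} (hπ : ∀ i, ¬ Inner τ π₀ i → π i = π₀ i)
    (hπ' : ∀ i, ¬ Inner τ π₀ i → π' i = π₀ i) (h : code τ π₀ π = code τ π₀ π') : π = π' := by
  rw [← Equiv.symm_bijective.injective.eq_iff]
  ext v
  by_cases hv : v ∈ innerValues τ π₀
  · exact List.map_inj_left.1 h v hv
  · rw [mem_innerValues] at hv
    have h1 := hπ _ hv
    have h2 := hπ' _ hv
    rw [Equiv.apply_symm_apply, ← Equiv.eq_symm_apply] at h1 h2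
    rw [← h1, ← h2]

lemma exists_code_eq {q : List ℕ} (hq : q.Perm (innerPositions τ π₀)) :
    ∃ π : Equiv.Perm (Fin N), (∀ i, ¬ Inner τ π₀ i → π i = π₀ i) ∧ code τ π₀ π = q := by
  obtain ⟨σ, h1, rfl⟩ := exists_perm_of_perm_map
    (hq.trans (code_perm (π := π₀) fun _ _ => rfl).symm) (pairwise_innerValues.imp ne_of_lt) rfl
  refine ⟨(σ.trans π₀.symm).symm, fun i hi => ?_, rfl⟩
  rw [Equiv.symm_apply_eq, Equiv.trans_apply, h1 _ (by simpa [mem_innerValues] using hi),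
    Equiv.symm_apply_apply]

lemma card_outline_eq {bad : ℕ → List ℕ → Prop} {P : Equiv.Perm (Fin N) → Prop}
    (hP : ∀ π : Equiv.Perm (Fin N), outline τ π = outline τ π₀ →
      (P π ↔ ∃ c ∈ code τ π₀ π, bad c ((code τ π₀ π).drop (offset τ π₀ c)))) :
    Nat.card {π : Equiv.Perm (Fin N) // outline τ π = outline τ π₀ ∧ ¬ P π} =
      Nat.card {q : List ℕ // q.Perm (innerPositions τ π₀) ∧ Good bad (offset τ π₀) q} := by
  refine Nat.card_congr (Equiv.ofBijective (fun π => ⟨code τ π₀ π.1, ?_, ?_⟩) ⟨?_, ?_⟩)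
  · exact code_perm (outline_eq_iff.1 π.2.1).1
  · have h := outline_eq_iff.1 π.2.1
    rw [good_code_iff h.1, ← hP _ π.2.1]
    exact ⟨h.2, π.2.2⟩
  · intro π π' h
    exact Subtype.ext (code_injOn (outline_eq_iff.1 π.2.1).1 (outline_eq_iff.1 π'.2.1).1
      (congrArg Subtype.val h))
  · rintro ⟨q, hq, hg⟩
    obtain ⟨π, hπ, rfl⟩ := exists_code_eq hq
    rw [good_code_iff hπ] at hg
    have h : outline τ π = outline τ π₀ := outline_eq_iff.2 ⟨hπ, hg.1⟩
    exact ⟨⟨π, h, (hP π h).not.2 hg.2⟩, rfl⟩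

lemma mem_innerValues_of_covers {π : Equiv.Perm (Fin N)} (h : outline τ π = outline τ π₀)
    {k : ℕ} {v w : Fin N} (hc : Covers τ π₀ k v) (hk : π.symm w ≤ k) (hv : v ≤ w) :
    w ∈ innerValues τ π₀ := by
  have hπ := (outline_eq_iff.1 h).1
  rw [← π.apply_symm_apply w, apply_mem_innerValues hπ]
  by_contra hn
  have := hπ _ hn
  rw [Equiv.apply_symm_apply] at this
  refine hn (hc.mono hk ?_)
  rwa [← this]

lemma exists_bad_code_iff {π : Equiv.Perm (Fin N)} {Q : ℕ → ℕ → ℕ → Prop} {c : ℕ} :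
    (∃ x y z, Q x y z ∧ [x, y, z].Sublist ((code τ π₀ π).drop (offset τ π₀ c))) ↔
      ∃ x y z, Q (π.symm x) (π.symm y) (π.symm z) ∧ x < y ∧ y < z ∧ Covers τ π₀ c x ∧
        x ∈ innerValues τ π₀ ∧ y ∈ innerValues τ π₀ ∧ z ∈ innerValues τ π₀ := by
  rw [drop_code]
  constructor
  · rintro ⟨a, b, d, hQ, h⟩
    obtain ⟨l, hl, h1⟩ := List.sublist_map_iff.1 h
    obtain ⟨x, l, rfl, rfl, h2⟩ := List.map_eq_cons_iff.1 h1.symm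
    obtain ⟨y, l, rfl, rfl, h3⟩ := List.map_eq_cons_iff.1 h2
    obtain ⟨z, l, rfl, rfl, h4⟩ := List.map_eq_cons_iff.1 h3
    obtain rfl := List.map_eq_nil_iff.1 h4
    rw [sublist_triple_iff (pairwise_innerValues.filter _)] at hl
    simp only [List.mem_filter, decide_eq_true_eq] at hl
    exact ⟨x, y, z, hQ, hl.2.1, hl.2.2, hl.1.1.2, hl.1.1.1, hl.1.2.1.1, hl.1.2.2.1⟩
  · rintro ⟨x, y, z, hQ, hxy, hyz, hc, hx, hy, hz⟩
    refine ⟨_, _, _, hQ, ?_⟩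
    refine List.Sublist.map (l₁ := [x, y, z]) (fun v : Fin N => (π.symm v : ℕ)) ?_
    rw [sublist_triple_iff (pairwise_innerValues.filter _)]
    simp only [List.mem_filter, decide_eq_true_eq]
    exact ⟨⟨⟨hx, hc⟩, ⟨hy, hc.mono le_rfl hxy.le⟩, hz, hc.mono le_rfl (hxy.trans hyz).le⟩, hxy, hyz⟩

lemma pattContains_213_iff {π : Equiv.Perm (Fin N)} (h : outline τ π = outline τ π₀) :
    PattContains (blockSum ![1, 0, 2] τ) π ↔
      ∃ c ∈ code τ π₀ π, Bad213 c ((code τ π₀ π).drop (offset τ π₀ c)) := by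
  have hπ := (outline_eq_iff.1 h).1
  rw [pattContains_blockSum_213]
  constructor
  · rintro ⟨i, j, k, hij, hjk, h1, h2, hc⟩
    rw [covers_iff_of_outline_eq h] at hc
    have hmem : ∀ l : Fin N, l ≤ k → π j ≤ π l → π l ∈ innerValues τ π₀ := fun l hl hl' =>
      mem_innerValues_of_covers h hc (by simpa using hl) hl'
    refine ⟨k, (mem_code hπ).2 ⟨k, (apply_mem_innerValues hπ).1
      (hmem k le_rfl (h1.trans h2).le), rfl⟩, ?_⟩
    have := (exists_bad_code_iff (τ := τ) (π₀ := π₀) (π := π) (c := k)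
      (Q := fun x y z => y < x ∧ x < k ∧ z = k)).2
        ⟨π j, π i, π k, by simpa using ⟨hij, hjk⟩, h1, h2, hc,
        hmem j hjk.le le_rfl, hmem i (hij.trans hjk).le h1.le, hmem k le_rfl (h1.trans h2).le⟩
    obtain ⟨x, y, z, ⟨h3, h4, rfl⟩, h5⟩ := this
    exact ⟨x, y, h3, h4, h5⟩
  · rintro ⟨c, hc, x, y, h1, h2, h3⟩
    obtain ⟨x, y, z, ⟨h4, h5, h6⟩, h7, h8, h9, -⟩ := (exists_bad_code_iff
      (Q := fun x y z => y < x ∧ x < c ∧ z = c)).1 ⟨x, y, c, ⟨h1, h2, rfl⟩, h3⟩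
    subst h6
    refine ⟨π.symm y, π.symm x, π.symm z, h4, h5, by simpa, by simpa, ?_⟩
    rw [covers_iff_of_outline_eq h]
    simpa

lemma pattContains_132_iff {π : Equiv.Perm (Fin N)} (h : outline τ π = outline τ π₀) :
    PattContains (blockSum ![0, 2, 1] τ) π ↔
      ∃ c ∈ code τ π₀ π, Bad132 c ((code τ π₀ π).drop (offset τ π₀ c)) := by
  have hπ := (outline_eq_iff.1 h).1
  rw [pattContains_blockSum_132]
  constructor
  · rintro ⟨i, j, k, hij, hjk, h1, h2, hc⟩
    rw [covers_iff_of_outline_eq h] at hc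
    have hmem : ∀ l : Fin N, l ≤ k → π i ≤ π l → π l ∈ innerValues τ π₀ := fun l hl hl' =>
      mem_innerValues_of_covers h hc (by simpa using hl) hl'
    refine ⟨k, (mem_code hπ).2 ⟨k, (apply_mem_innerValues hπ).1
      (hmem k le_rfl h1.le), rfl⟩, ?_⟩
    have := (exists_bad_code_iff (τ := τ) (π₀ := π₀) (π := π) (c := k)
      (Q := fun x y z => x < z ∧ z < k ∧ y = k)).2
        ⟨π i, π k, π j, by simpa using ⟨hij, hjk⟩, h1, h2, hc,
        hmem i (hij.trans hjk).le le_rfl, hmem k le_rfl h1.le, hmem j hjk.le (h1.trans h2).le⟩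
    obtain ⟨x, y, z, ⟨h3, h4, rfl⟩, h5⟩ := this
    exact ⟨x, z, h3, h4, h5⟩
  · rintro ⟨c, hc, x, y, h1, h2, h3⟩
    obtain ⟨x, y, z, ⟨h4, h5, h6⟩, h7, h8, h9, -⟩ := (exists_bad_code_iff
      (Q := fun x y z => x < z ∧ z < c ∧ y = c)).1 ⟨x, c, y, ⟨h1, h2, rfl⟩, h3⟩
    subst h6
    refine ⟨π.symm x, π.symm z, π.symm y, h4, h5, by simpa, by simpa, ?_⟩
    rw [covers_iff_of_outline_eq h]
    simpa

lemma card_outline_avoiding_eq :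
    Nat.card {π : Equiv.Perm (Fin N) // outline τ π = outline τ π₀ ∧
        ¬ PattContains (blockSum ![1, 0, 2] τ) π} =
      Nat.card {π : Equiv.Perm (Fin N) // outline τ π = outline τ π₀ ∧
        ¬ PattContains (blockSum ![0, 2, 1] τ) π} := by
  rw [card_outline_eq fun _ => pattContains_213_iff, card_outline_eq fun _ => pattContains_132_iff]
  exact card_good_eq admissible_innerPositions fun c _ => offset_le c

end Coding

lemma card_subtype_eq_of_fiberwise {α β : Type*} [Finite α] {P Q : α → Prop} (f : α → β)
    (h : ∀ a₀, Nat.card {a // f a = f a₀ ∧ P a} = Nat.card {a // f a = f a₀ ∧ Q a}) :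
    Nat.card {a // P a} = Nat.card {a // Q a} := by
  classical
  cases nonempty_fintype α
  simp only [Nat.card_eq_fintype_card, Fintype.card_subtype] at h ⊢
  have key : ∀ R : α → Prop, ∀ a ∈ Finset.univ.filter R, f a ∈ Finset.univ.image f := by simp
  rw [Finset.card_eq_sum_card_fiberwise (key P), Finset.card_eq_sum_card_fiberwise (key Q)]
  refine Finset.sum_congr rfl fun b hb => ?_
  obtain ⟨a₀, -, rfl⟩ := Finset.mem_image.1 hb
  simpa only [Finset.filter_filter, and_comm] using h a₀

end BlockWilf

/-- For any `τ ∈ S_{n-3}` (here of length `m = n - 3`), the patterns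
`(n-1, n-2, n, τ)` and `(n-2, n, n-1, τ)` are Wilf-equivalent: the first is the block
sum of 213 (as `![1,0,2]`) with `τ`, the second the block sum of 132 (as `![0,2,1]`)
with `τ`, the first three positions taking the three largest values. -/
theorem wilf_equiv_block_213_132 (m : ℕ) (τ : Equiv.Perm (Fin m)) (N : ℕ) :
    avoiders (blockSum (![1,0,2] : Fin 3 → Fin 3) (⇑τ)) N
      = avoiders (blockSum (![0,2,1] : Fin 3 → Fin 3) (⇑τ)) N :=
  BlockWilf.card_subtype_eq_of_fiberwise
    (fun π : Equiv.Perm (Fin N) => BlockWilf.outline (⇑τ) (⇑π))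
    fun _ => BlockWilf.card_outline_avoiding_eq
end

section
/- The patterns 3142 and 2413 are not shape-Wilf-equivalent: the Young diagram Y(6,6,6,6,5,5) has 394 transversals avoiding 3142 but 395 transversals avoiding 2413. -/
/-- The Young diagram `Y(6,6,6,6,5,5)` (row lengths from the bottom: 5,5,6,6,6,6). -/
def Y665 : ℕ → ℕ := fun i => if i < 2 then 5 else 6

theorem ofFn_perm_injective (n : ℕ) :
    Function.Injective (fun π : Equiv.Perm (Fin n) => List.ofFn fun i => (π i : ℕ)) := by
  intro π σ h
  ext i
  exact congrFun (List.ofFn_injective h) i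

/-- The permutations of `Fin n`, written in one-line notation, are exactly the
rearrangements of `0, 1, ..., n - 1`. -/
theorem image_ofFn_perm (n : ℕ) :
    (Finset.univ : Finset (Equiv.Perm (Fin n))).image
        (fun π => List.ofFn fun i => (π i : ℕ)) =
      (List.range n).permutations'.toFinset := by
  refine Finset.eq_of_subset_of_card_le ?_ ?_
  · intro l hl
    obtain ⟨π, -, rfl⟩ := Finset.mem_image.1 hl
    rw [List.mem_toFinset, List.mem_permutations']
    have h := Equiv.Perm.ofFn_comp_perm π (fun i : Fin n => (i : ℕ))
    have hr : List.ofFn (fun i : Fin n => (i : ℕ)) = List.range n := by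
      apply List.ext_getElem <;> simp
    rw [hr] at h
    exact h
  · rw [Finset.card_image_of_injective _ (ofFn_perm_injective n), Finset.card_univ, Fintype.card_perm,
      Fintype.card_fin]
    refine (List.toFinset_card_le _).trans ?_
    rw [(List.permutations_perm_permutations' _).symm.length_eq, List.length_permutations,
      List.length_range]

/-- Counting permutations by running through their one-line notations. -/
theorem natCard_perm_subtype_eq_countP {n : ℕ} (P : Equiv.Perm (Fin n) → Prop)
    (T : List ℕ → Bool) (h : ∀ π, P π ↔ T (List.ofFn fun i => (π i : ℕ)) = true) :
    Nat.card {π // P π} = (List.range n).permutations'.countP T := by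
  classical
  have hnodup : (List.range n).permutations'.Nodup :=
    (List.permutations_perm_permutations' _).nodup_iff.1
      (List.nodup_permutations _ List.nodup_range)
  rw [Nat.card_eq_fintype_card, Fintype.card_subtype, List.countP_eq_length_filter,
    ← List.toFinset_card_of_nodup (hnodup.filter T), List.toFinset_filter,
    ← image_ofFn_perm, Finset.filter_image,
    Finset.card_image_of_injective _ (ofFn_perm_injective n)]
  simp only [h]

/-- An order embedding of `Fin 4` is an increasing quadruple. -/
theorem exists_orderEmbedding_fin_four {α : Type*} [LinearOrder α]
    (P : α → α → α → α → Prop) :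
    (∃ f : Fin 4 ↪o α, P (f 0) (f 1) (f 2) (f 3)) ↔
      ∃ i j k l, i < j ∧ j < k ∧ k < l ∧ P i j k l := by
  constructor
  · rintro ⟨f, hf⟩
    exact ⟨f 0, f 1, f 2, f 3, f.lt_iff_lt.2 (by decide), f.lt_iff_lt.2 (by decide),
      f.lt_iff_lt.2 (by decide), hf⟩
  · rintro ⟨i, j, k, l, hij, hjk, hkl, hP⟩
    refine ⟨OrderEmbedding.ofStrictMono ![i, j, k, l] ?_, hP⟩
    rw [Fin.strictMono_iff_lt_succ]
    intro a
    fin_cases a <;> assumption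

/-- Whether the word `w` has an occurrence of a pattern of length four whose order
condition on values is `r`, with all crossing cells in rows at least as long as
prescribed by `b`. -/
def occursIn (b : ℕ → ℕ) (r : ℕ → ℕ → ℕ → ℕ → Bool) (w : List ℕ) : Bool :=
  (List.range w.length).any fun l => (List.range l).any fun k =>
    (List.range k).any fun j => (List.range j).any fun i =>
      r (w.getD i 0) (w.getD j 0) (w.getD k 0) (w.getD l 0) &&
        [i, j, k, l].all fun c => Nat.blt l (b (w.getD c 0))

/-- Whether the word `w` is a transversal of the shape `b`. -/
def fitsIn (b : ℕ → ℕ) (w : List ℕ) : Bool :=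
  (List.range w.length).all fun i => Nat.blt i (b (w.getD i 0))

theorem isTransversal_iff_fitsIn {n : ℕ} (b : ℕ → ℕ) (π : Equiv.Perm (Fin n)) :
    IsTransversal n b π ↔ fitsIn b (List.ofFn fun i => (π i : ℕ)) = true := by
  simp only [IsTransversal, fitsIn, List.all_eq_true, List.length_ofFn, List.mem_range,
    Nat.blt_eq, Fin.forall_iff]
  refine forall₂_congr fun i hi => ?_
  simp [List.getD_eq_getElem?_getD, hi]

theorem shapeContains_iff_occursIn {n : ℕ} (b : ℕ → ℕ) (π : Fin n → Fin n)
    (τ : Fin 4 → Fin 4) (r : ℕ → ℕ → ℕ → ℕ → Bool)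
    (hr : ∀ v : Fin 4 → ℕ,
      (∀ a c, τ a < τ c ↔ v a < v c) ↔ r (v 0) (v 1) (v 2) (v 3) = true) :
    ShapeContains n b π τ ↔ occursIn b r (List.ofFn fun i => (π i : ℕ)) = true := by
  have key : ShapeContains n b π τ ↔ ∃ f : Fin 4 ↪o Fin n,
      r (π (f 0)) (π (f 1)) (π (f 2)) (π (f 3)) = true ∧
        ∀ c, (f 3 : ℕ) < b (π (f c)) := by
    refine exists_congr fun f => and_congr (hr fun a => (π (f a) : ℕ)) ?_
    refine ⟨fun h c => h 3 c, fun h a c => lt_of_le_of_lt ?_ (h c)⟩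
    exact f.monotone (Fin.le_last a)
  have hget : ∀ i : Fin n, (List.ofFn fun i => (π i : ℕ)).getD i 0 = π i := fun i => by
    simp [List.getD_eq_getElem?_getD]
  rw [key]
  simp only [Fin.forall_fin_succ, IsEmpty.forall_iff, and_true]
  refine (exists_orderEmbedding_fin_four (fun i j k l =>
    r (π i) (π j) (π k) (π l) = true ∧ (l : ℕ) < b (π i) ∧ (l : ℕ) < b (π j) ∧
      (l : ℕ) < b (π k) ∧ (l : ℕ) < b (π l))).trans ?_
  simp only [occursIn, List.any_eq_true, List.length_ofFn, List.mem_range, Bool.and_eq_true,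
    List.all_cons, List.all_nil, Nat.blt_eq, and_true]
  constructor
  · rintro ⟨i, j, k, l, hij, hjk, hkl, h⟩
    refine ⟨l, l.2, k, hkl, j, hjk, i, hij, ?_⟩
    simpa only [hget] using h
  · rintro ⟨l, hl, k, hkl, j, hjk, i, hij, h⟩
    lift l to Fin n using hl
    lift k to Fin n using hkl.trans l.2
    lift j to Fin n using hjk.trans k.2
    lift i to Fin n using hij.trans j.2
    simp only [hget] at h
    exact ⟨i, j, k, l, hij, hjk, hkl, h⟩

theorem shapeAvoidCard_eq_countP (n : ℕ) (b : ℕ → ℕ) (τ : Fin 4 → Fin 4)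
    (r : ℕ → ℕ → ℕ → ℕ → Bool)
    (hr : ∀ v : Fin 4 → ℕ,
      (∀ a c, τ a < τ c ↔ v a < v c) ↔ r (v 0) (v 1) (v 2) (v 3) = true) :
    shapeAvoidCard n b τ =
      (List.range n).permutations'.countP fun w => fitsIn b w && !occursIn b r w := by
  refine natCard_perm_subtype_eq_countP _ _ fun π => ?_
  rw [isTransversal_iff_fitsIn, shapeContains_iff_occursIn b π τ r hr]
  simp

theorem shapeAvoidCard_Y665_3142 :
    shapeAvoidCard 6 Y665 (![2,0,3,1] : Fin 4 → Fin 4) = 394 := by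
  rw [shapeAvoidCard_eq_countP 6 Y665 _
    (fun w x y z => Nat.blt x z && Nat.blt z w && Nat.blt w y)]
  · decide +kernel
  · intro v
    simp [Fin.forall_fin_succ]
    omega

theorem shapeAvoidCard_Y665_2413 :
    shapeAvoidCard 6 Y665 (![1,3,0,2] : Fin 4 → Fin 4) = 395 := by
  rw [shapeAvoidCard_eq_countP 6 Y665 _
    (fun w x y z => Nat.blt y w && Nat.blt w z && Nat.blt z x)]
  · decide +kernel
  · intro v
    simp [Fin.forall_fin_succ]
    omega

theorem isYoungShape_Y665 : IsYoungShape 6 Y665 := by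
  refine ⟨fun i j hij hj => ?_, fun i hi => ?_⟩ <;> unfold Y665 <;> split_ifs <;> omega

/-- 3142 and 2413 are not shape-Wilf-equivalent: `Y(6,6,6,6,5,5)` has 394 transversals
avoiding 3142 but 395 avoiding 2413. -/
theorem not_swe_3142_2413 :
    shapeAvoidCard 6 Y665 (![2,0,3,1] : Fin 4 → Fin 4) = 394 ∧
    shapeAvoidCard 6 Y665 (![1,3,0,2] : Fin 4 → Fin 4) = 395 ∧
    ¬ ShapeWilfEquiv (![2,0,3,1] : Fin 4 → Fin 4) (![1,3,0,2] : Fin 4 → Fin 4) := by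
  refine ⟨shapeAvoidCard_Y665_3142, shapeAvoidCard_Y665_2413, fun h => ?_⟩
  have := h 6 Y665 isYoungShape_Y665
  rw [shapeAvoidCard_Y665_3142, shapeAvoidCard_Y665_2413] at this
  omega
end
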